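/- Let p be a prime and n ≥ 1. There is no free continuous action of the group ℤ/p × ℤ/p on the sphere S^n. Equivalently, if (ℤ/p)^r acts freely and continuously on S^n, then r ≤ 1. -/

import Mathlib

open Topology

/-! ### Alexander–Spanier cochains

Cochains are functions on finite lists of points; a list of length `j` is an
`(j - 1)`-simplex, so that the complex is augmented by the functions on the empty list. -/

namespace AlexanderSpanier

section Cochains

variable {X Y k : Type*} [Field k]

/-- The value of the simplicial coboundary of a cochain on a list of points. -/
def coboundaryEval : List X → (List X → k) → k
  | [], _ => 0
  | x :: τ, f => f τ - coboundaryEval τ fun σ => f (x :: σ)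

/-- The simplicial coboundary. -/
def coboundary : Module.End k (List X → k) where
  toFun f τ := coboundaryEval τ f
  map_add' f g := by
    funext τ
    induction τ generalizing f g with
    | nil => simp [coboundaryEval]
    | cons x τ ih =>
      have := ih (fun σ => f (x :: σ)) (fun σ => g (x :: σ))
      simp only [Pi.add_apply, coboundaryEval] at this ⊢
      rw [← sub_eq_zero] at this ⊢
      rw [← neg_eq_zero, ← this]
      simp only [Pi.add_def]
      ring
  map_smul' c f := by
    funext τ
    induction τ generalizing f with
    | nil => simp [coboundaryEval]
    | cons x τ ih =>
      have := ih (fun σ => f (x :: σ))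
      simp only [Pi.smul_apply, coboundaryEval, smul_eq_mul, RingHom.id_apply] at this ⊢
      rw [mul_sub, ← this]
      rfl

@[simp] lemma coboundary_nil (f : List X → k) : coboundary f [] = 0 := rfl

lemma coboundary_cons (f : List X → k) (x : X) (τ : List X) :
    coboundary f (x :: τ) = f τ - coboundary (fun σ => f (x :: σ)) τ := rfl

lemma coboundary_cons' (f : List X → k) (x : X) :
    (fun τ => coboundary f (x :: τ)) = f - coboundary (fun σ => f (x :: σ)) := rfl

lemma coboundary_coboundary (f : List X → k) : coboundary (coboundary f) = 0 := by
  funext τ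
  induction τ generalizing f with
  | nil => rfl
  | cons x τ ih =>
    rw [coboundary_cons, coboundary_cons', map_sub, Pi.sub_apply, ih]
    simp

/-- Pullback of cochains along a map of points. -/
def pullback (φ : X → Y) : (List Y → k) →ₗ[k] (List X → k) where
  toFun f τ := f (τ.map φ)
  map_add' _ _ := rfl
  map_smul' _ _ := rfl

lemma pullback_apply (φ : X → Y) (f : List Y → k) (τ : List X) :
    pullback φ f τ = f (τ.map φ) := rfl

lemma coboundary_pullback (φ : X → Y) (f : List Y → k) :
    coboundary (pullback φ f) = pullback φ (coboundary f) := by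
  funext τ
  induction τ generalizing f with
  | nil => rfl
  | cons x τ ih =>
    rw [coboundary_cons, pullback_apply, pullback_apply, List.map_cons, coboundary_cons]
    exact congrArg _ (ih fun σ => f (φ x :: σ))

lemma pullback_id (f : List X → k) : pullback (fun x => x) f = f := by
  funext τ
  simp [pullback_apply]

lemma coboundary_eq_zero {f : List X → k} {j : ℕ} {τ : List X} (hτ : τ.length = j + 1)
    (h : ∀ σ : List X, σ.length = j → (∀ y ∈ σ, y ∈ τ) → f σ = 0) : coboundary f τ = 0 := by
  induction τ generalizing f j with
  | nil => rfl
  | cons x τ ih =>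
    rw [coboundary_cons, h τ (by simpa using hτ) fun y hy => List.mem_cons_of_mem _ hy, zero_sub,
      neg_eq_zero]
    cases j with
    | zero =>
      obtain rfl : τ = [] := by simpa using hτ
      rfl
    | succ j =>
      refine ih (by simpa using hτ) fun σ hσ hmem => h _ (by simp [hσ]) ?_
      simp only [List.mem_cons]
      rintro y (rfl | hy)
      · exact Or.inl rfl
      · exact Or.inr (hmem y hy)

lemma coboundary_length (φ : ℕ → k) (τ : List X) :
    coboundary (fun σ => φ σ.length) τ = if Odd τ.length then φ (τ.length - 1) else 0 := by
  induction τ generalizing φ with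
  | nil => simp
  | cons x τ ih =>
    have := ih fun l => φ (l + 1)
    simp only [coboundary_cons, List.length_cons] at this ⊢
    rw [this]
    by_cases h : Odd τ.length
    · have h' : ¬ Odd (τ.length + 1) := by simpa [Nat.odd_add_one] using h
      simp [h, h', Nat.sub_add_cancel h.pos]
    · have h' : Odd (τ.length + 1) := by simpa [Nat.odd_add_one] using h
      simp [h, h']

/-- The prism operator between the pullbacks along two maps. -/
def prism (φ ψ : X → Y) : List X → (List Y → k) → k
  | [], _ => 0
  | x :: τ, f => f (φ x :: ψ x :: τ.map ψ) - prism φ ψ τ fun σ => f (φ x :: σ)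

lemma prism_sub (φ ψ : X → Y) (τ : List X) (f g : List Y → k) :
    prism φ ψ τ (f - g) = prism φ ψ τ f - prism φ ψ τ g := by
  induction τ generalizing f g with
  | nil => simp [prism]
  | cons x τ ih =>
    have := ih (fun σ => f (φ x :: σ)) (fun σ => g (φ x :: σ))
    simp only [prism, Pi.sub_apply] at this ⊢
    rw [show (fun σ => f (φ x :: σ) - g (φ x :: σ)) =
      (fun σ => f (φ x :: σ)) - (fun σ => g (φ x :: σ)) from rfl, this]
    ring

lemma prism_identity (φ ψ : X → Y) (f : List Y → k) (τ : List X) :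
    coboundary (fun σ => prism φ ψ σ f) τ + prism φ ψ τ (coboundary f) =
      pullback ψ f τ - pullback φ f τ := by
  induction τ generalizing f with
  | nil => simp [prism, pullback_apply]
  | cons x τ ih =>
    have h1 : (fun σ => prism φ ψ (x :: σ) f) =
        pullback ψ (fun σ => f (φ x :: ψ x :: σ)) -
          fun σ => prism φ ψ σ fun σ' => f (φ x :: σ') := rfl
    have h2 := ih fun σ => f (φ x :: σ)
    rw [coboundary_cons, h1, map_sub, coboundary_pullback, prism, coboundary_cons', prism_sub,
      coboundary_cons, coboundary_cons]
    simp only [Pi.sub_apply, pullback_apply, List.map_cons] at h2 ⊢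
    linear_combination h2

lemma prism_eq_zero {φ ψ : X → Y} {f : List Y → k} {τ : List X}
    (h : ∀ σ : List Y, σ.length = τ.length + 1 → (∀ y ∈ σ, ∃ z ∈ τ, y = φ z ∨ y = ψ z) →
      f σ = 0) : prism φ ψ τ f = 0 := by
  induction τ generalizing f with
  | nil => rfl
  | cons x τ ih =>
    rw [prism, h _ (by simp), zero_sub, neg_eq_zero]
    · refine ih fun σ hσ hmem => h _ (by simp [hσ]) ?_
      simp only [List.mem_cons]
      rintro y (rfl | hy)
      · exact ⟨x, Or.inl rfl, Or.inl rfl⟩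
      · obtain ⟨z, hz, h⟩ := hmem y hy
        exact ⟨z, Or.inr hz, h⟩
    · simp only [List.mem_cons, List.mem_map]
      rintro y (rfl | rfl | ⟨z, hz, rfl⟩)
      · exact ⟨x, Or.inl rfl, Or.inl rfl⟩
      · exact ⟨x, Or.inl rfl, Or.inr rfl⟩
      · exact ⟨z, Or.inr hz, Or.inr rfl⟩

lemma pullback_pullback_eq_self {ι : X → Y} {r : Y → X} (h : ∀ x, r (ι x) = x) (f : List X → k) :
    pullback ι (pullback r f) = f := by
  funext τ
  simp [pullback_apply, Function.comp_def, h]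

end Cochains

section LocallyZero

variable {X Y k : Type*} [TopologicalSpace X] [TopologicalSpace Y] [Field k]

variable (k) in
/-- The cochains that vanish on the lists of length `j` of nearby points of `A`
(and on the empty list if `j = 0`). -/
def locallyZero (A : Set X) (j : ℕ) : Submodule k (List X → k) where
  carrier := {f | (∀ x ∈ A, ∃ U ∈ 𝓝 x, ∀ τ : List X, τ.length = j →
    (∀ y ∈ τ, y ∈ U ∧ y ∈ A) → f τ = 0) ∧ (j = 0 → f [] = 0)}
  zero_mem' := ⟨fun _ _ => ⟨Set.univ, Filter.univ_mem, fun _ _ _ => rfl⟩, fun _ => rfl⟩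
  add_mem' := by
    rintro f g ⟨hf, hf0⟩ ⟨hg, hg0⟩
    refine ⟨fun x hx => ?_, fun hj => by simp [hf0 hj, hg0 hj]⟩
    obtain ⟨U, hU, hfU⟩ := hf x hx
    obtain ⟨V, hV, hgV⟩ := hg x hx
    refine ⟨U ∩ V, Filter.inter_mem hU hV, fun τ hτ h => ?_⟩
    rw [Pi.add_apply, hfU τ hτ fun y hy => ⟨(h y hy).1.1, (h y hy).2⟩,
      hgV τ hτ fun y hy => ⟨(h y hy).1.2, (h y hy).2⟩, add_zero]
  smul_mem' := by
    rintro c f ⟨hf, hf0⟩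
    refine ⟨fun x hx => ?_, fun hj => by simp [hf0 hj]⟩
    obtain ⟨U, hU, hfU⟩ := hf x hx
    exact ⟨U, hU, fun τ hτ h => by rw [Pi.smul_apply, hfU τ hτ h, smul_zero]⟩

lemma mem_locallyZero_of_forall {A : Set X} {j : ℕ} {f : List X → k}
    (h : ∀ τ : List X, τ.length = j → f τ = 0) : f ∈ locallyZero k A j :=
  ⟨fun _ _ => ⟨Set.univ, Filter.univ_mem, fun τ hτ _ => h τ hτ⟩, fun hj => h [] (by simp [hj])⟩

lemma locallyZero_anti {A B : Set X} (h : A ⊆ B) (j : ℕ) :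
    locallyZero k B j ≤ locallyZero k A j := by
  rintro f ⟨hf, hf0⟩
  refine ⟨fun x hx => ?_, hf0⟩
  obtain ⟨U, hU, hfU⟩ := hf x (h hx)
  exact ⟨U, hU, fun τ hτ hmem => hfU τ hτ fun y hy => ⟨(hmem y hy).1, h (hmem y hy).2⟩⟩

lemma coboundary_mem_locallyZero {A : Set X} {j : ℕ} {f : List X → k}
    (hf : f ∈ locallyZero k A j) : coboundary f ∈ locallyZero k A (j + 1) := by
  refine ⟨fun x hx => ?_, fun h => by simp at h⟩
  obtain ⟨U, hU, hfU⟩ := hf.1 x hx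
  exact ⟨U, hU, fun τ hτ hmem =>
    coboundary_eq_zero hτ fun σ hσ hσ' => hfU σ hσ fun y hy => hmem y (hσ' y hy)⟩

lemma pullback_mem_locallyZero {A : Set X} {B : Set Y} {φ : X → Y} (hφ : ContinuousOn φ A)
    (hAB : Set.MapsTo φ A B) {j : ℕ} {f : List Y → k} (hf : f ∈ locallyZero k B j) :
    pullback φ f ∈ locallyZero k A j := by
  refine ⟨fun x hx => ?_, hf.2⟩
  obtain ⟨U, hU, hfU⟩ := hf.1 (φ x) (hAB hx)
  obtain ⟨V, hV, hVU⟩ := mem_nhdsWithin_iff_exists_mem_nhds_inter.1 (hφ x hx hU)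
  refine ⟨V, hV, fun τ hτ h => hfU _ (by simpa using hτ) ?_⟩
  simp only [List.mem_map]
  rintro _ ⟨z, hz, rfl⟩
  exact ⟨hVU (h z hz), hAB (h z hz).2⟩

lemma pullback_congr {Y : Type*} {A : Set X} {φ ψ : X → Y} (h : ∀ x ∈ A, φ x = ψ x) {j : ℕ}
    (f : List Y → k) : pullback φ f - pullback ψ f ∈ locallyZero k A j := by
  refine ⟨fun x hx => ⟨Set.univ, Filter.univ_mem, fun τ _ hτ => ?_⟩, fun _ => sub_self _⟩
  rw [Pi.sub_apply, pullback_apply, pullback_apply,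
    List.map_congr_left fun y hy => h y (hτ y hy).2, sub_self]

variable (k) in
/-- Every cocycle of degree `j` on `A` is a coboundary, up to locally zero cochains. -/
def ExactAt (A : Set X) (j : ℕ) : Prop :=
  ∀ f : List X → k, coboundary f ∈ locallyZero k A (j + 1) →
    ∃ g, f - coboundary g ∈ locallyZero k A j

variable (k) in
/-- Any two cocycles of degree `j` on `A` are linearly dependent modulo coboundaries. -/
def RankLEOneAt (A : Set X) (j : ℕ) : Prop :=
  ∀ f₁ f₂ : List X → k, coboundary f₁ ∈ locallyZero k A (j + 1) →
    coboundary f₂ ∈ locallyZero k A (j + 1) → ∃ c₁ c₂ : k, (c₁ ≠ 0 ∨ c₂ ≠ 0) ∧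
      ∃ g, c₁ • f₁ + c₂ • f₂ - coboundary g ∈ locallyZero k A j

lemma homotopy_step {A : Set X} {B : Set Y} (hA : IsCompact A) {H : ℝ → X → Y}
    (hH : ContinuousOn (Function.uncurry H) (Set.Icc 0 1 ×ˢ A))
    (hAB : ∀ t ∈ Set.Icc (0 : ℝ) 1, Set.MapsTo (H t) A B) {j : ℕ} {f : List Y → k}
    (hf : coboundary f ∈ locallyZero k B (j + 1)) {t : ℝ} (ht : t ∈ Set.Icc (0 : ℝ) 1) :
    ∀ᶠ s in 𝓝[Set.Icc 0 1] t,
      ∃ g, pullback (H s) f - pullback (H t) f - coboundary g ∈ locallyZero k A j := by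
  have key : ∀ x ∈ A, ∃ V : Set X, IsOpen V ∧ x ∈ V ∧ ∀ᶠ s in 𝓝[Set.Icc 0 1] t, ∃ U : Set Y,
      (∀ σ : List Y, σ.length = j + 1 → (∀ y ∈ σ, y ∈ U ∧ y ∈ B) → coboundary f σ = 0) ∧
      ∀ y ∈ V ∩ A, H t y ∈ U ∧ H s y ∈ U := by
    intro x hx
    obtain ⟨U, hU, hfU⟩ := hf.1 (H t x) (hAB t ht hx)
    have h1 := hH (t, x) ⟨ht, hx⟩ hU
    rw [nhdsWithin_prod_eq] at h1
    obtain ⟨S, hS, V, hV, hSV⟩ := Filter.mem_prod_iff.1 h1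
    obtain ⟨V', hV'o, hxV', hV'⟩ := mem_nhdsWithin.1 hV
    refine ⟨V', hV'o, hxV', Filter.mem_of_superset hS fun s hs => ⟨U, hfU, fun y hy => ⟨?_, ?_⟩⟩⟩
    · exact hSV (Set.mk_mem_prod (mem_of_mem_nhdsWithin ht hS) (hV' hy))
    · exact hSV (Set.mk_mem_prod hs (hV' hy))
  choose! V hVo hxV hs using key
  obtain ⟨F, hFA, hF⟩ := hA.elim_nhds_subcover V fun x hx => (hVo x hx).mem_nhds (hxV x hx)
  have h2 : ∀ᶠ s in 𝓝[Set.Icc 0 1] t, ∀ x ∈ F, ∃ U : Set Y,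
      (∀ σ : List Y, σ.length = j + 1 → (∀ y ∈ σ, y ∈ U ∧ y ∈ B) → coboundary f σ = 0) ∧
      ∀ y ∈ V x ∩ A, H t y ∈ U ∧ H s y ∈ U :=
    (Filter.eventually_all_finset F).2 fun x hx => hs x (hFA x hx)
  filter_upwards [h2, self_mem_nhdsWithin] with s hs hsI
  refine ⟨fun σ => prism (H t) (H s) σ f, fun x hx => ?_, ?_⟩
  · obtain ⟨x', hx'F, hxx'⟩ := Set.mem_iUnion₂.1 (hF hx)
    obtain ⟨U, hfU, hHU⟩ := hs x' hx'F
    refine ⟨V x', (hVo x' (hFA x' hx'F)).mem_nhds hxx', fun τ hτ hmem => ?_⟩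
    have h3 : prism (H t) (H s) τ (coboundary f) = 0 := by
      refine prism_eq_zero fun σ hσ hσ' => hfU σ (by rw [hσ, hτ]) fun y hy => ?_
      obtain ⟨z, hz, rfl | rfl⟩ := hσ' y hy
      · exact ⟨(hHU z (hmem z hz)).1, hAB t ht (hmem z hz).2⟩
      · exact ⟨(hHU z (hmem z hz)).2, hAB s hsI (hmem z hz).2⟩
    have h4 := prism_identity (H t) (H s) f τ
    rw [h3, add_zero] at h4
    simp [h4]
  · rintro rfl
    simp [pullback_apply]

lemma pullback_homotopy {A : Set X} {B : Set Y} (hA : IsCompact A) {H : ℝ → X → Y}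
    (hH : ContinuousOn (Function.uncurry H) (Set.Icc 0 1 ×ˢ A))
    (hAB : ∀ t ∈ Set.Icc (0 : ℝ) 1, Set.MapsTo (H t) A B) {j : ℕ} {f : List Y → k}
    (hf : coboundary f ∈ locallyZero k B (j + 1)) :
    ∃ g, pullback (H 0) f - pullback (H 1) f - coboundary g ∈ locallyZero k A j := by
  let P : ℝ → ℝ → Prop := fun s t =>
    ∃ g, pullback (H s) f - pullback (H t) f - coboundary g ∈ locallyZero k A j
  have symm : ∀ s t, P s t → P t s := by
    rintro s t ⟨g, hg⟩
    refine ⟨-g, ?_⟩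
    convert neg_mem hg using 1
    rw [map_neg]
    abel
  refine isPreconnected_Icc.induction₂ P (fun t ht => ?_) ?_ ?_
    (Set.left_mem_Icc.2 zero_le_one) (Set.right_mem_Icc.2 zero_le_one)
  · exact (homotopy_step hA hH hAB hf ht).mono fun s hs => symm s t hs
  · rintro r s t - - - ⟨g, hg⟩ ⟨g', hg'⟩
    refine ⟨g + g', ?_⟩
    convert add_mem hg hg' using 1
    rw [map_add]
    abel
  · exact fun _ _ _ _ => symm _ _

lemma pullback_const {A : Set X} {B : Set Y} {c : Y} (hc : c ∈ B) {j : ℕ} {f : List Y → k}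
    (hf : coboundary f ∈ locallyZero k B (j + 1)) :
    ∃ g, pullback (fun _ : X => c) f - coboundary g ∈ locallyZero k A j := by
  have h1 : pullback (fun _ : X => c) f = fun τ => (fun l => f (List.replicate l c)) τ.length := by
    funext τ
    simp [pullback_apply]
  rw [h1]
  by_cases hj : Odd j
  · refine ⟨fun τ => (fun _ => f (List.replicate j c)) τ.length,
      mem_locallyZero_of_forall fun τ hτ => ?_⟩
    rw [Pi.sub_apply, coboundary_length fun _ => f (List.replicate j c), hτ, if_pos hj, sub_self]
  · refine ⟨0, mem_locallyZero_of_forall fun τ hτ => ?_⟩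
    obtain ⟨U, hU, hfU⟩ := hf.1 c hc
    have h2 := hfU (List.replicate (j + 1) c) (by simp) fun y hy => by
      rw [List.eq_of_mem_replicate hy]
      exact ⟨mem_of_mem_nhds hU, hc⟩
    have h3 := congrFun (coboundary_pullback (fun _ : Y => c) f) (List.replicate (j + 1) c)
    rw [pullback_apply, List.map_replicate, h2] at h3
    have h4 : pullback (fun _ : Y => c) f =
        fun τ => (fun l => f (List.replicate l c)) τ.length := by
      funext τ
      simp [pullback_apply]
    have hj' : Odd (j + 1) := by simpa [Nat.odd_add_one] using hj
    rw [h4, coboundary_length fun l => f (List.replicate l c), List.length_replicate,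
      if_pos hj'] at h3
    simpa [hτ] using h3

/-- A cocycle on `B` restricts to a coboundary on a set `A` that contracts in `B`. -/
lemma exists_coboundary_of_contraction {A B : Set X} (hA : IsCompact A) {H : ℝ → X → X}
    (hH : ContinuousOn (Function.uncurry H) (Set.Icc 0 1 ×ˢ A))
    (hAB : ∀ t ∈ Set.Icc (0 : ℝ) 1, Set.MapsTo (H t) A B) {c : X} (hc : c ∈ B)
    (h0 : ∀ x ∈ A, H 0 x = x) (h1 : ∀ x ∈ A, H 1 x = c) {j : ℕ} {f : List X → k}
    (hf : coboundary f ∈ locallyZero k B (j + 1)) :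
    ∃ g, f - coboundary g ∈ locallyZero k A j := by
  obtain ⟨g, hg⟩ := pullback_homotopy hA hH hAB hf
  obtain ⟨g', hg'⟩ := pullback_const (X := X) (A := A) hc hf
  have h3 := pullback_congr h0 (j := j) f
  have h4 := pullback_congr h1 (j := j) f
  refine ⟨g + g', ?_⟩
  convert sub_mem (add_mem (add_mem hg hg') h4) h3 using 1
  rw [map_add, pullback_id]
  abel

lemma sub_mem_locallyZero_of_glue {S A B : Set X} {j : ℕ} {a b g : List X → k} (hA : A ⊆ S)
    (hab : a - b ∈ locallyZero k (A ∩ B) j) (hg : ∀ τ, g τ = a τ ∨ g τ = b τ)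
    (h : ∀ x ∈ A, B ∈ 𝓝[S] x ∨ ∀ᶠ y in 𝓝[S] x, ∀ τ, g (y :: τ) = a (y :: τ)) :
    a - g ∈ locallyZero k A j := by
  have h0 : j = 0 → a [] - g [] = 0 := fun hj => by
    rcases hg [] with h | h
    · rw [h, sub_self]
    · rw [h]
      exact hab.2 hj
  refine ⟨fun x hx => ?_, h0⟩
  rcases h x hx with h | h
  · obtain ⟨V, hV, hVB⟩ := mem_nhdsWithin_iff_exists_mem_nhds_inter.1 h
    obtain ⟨U, hU, hUab⟩ := hab.1 x ⟨hx, hVB ⟨mem_of_mem_nhds hV, hA hx⟩⟩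
    refine ⟨U ∩ V, Filter.inter_mem hU hV, fun τ hτ hmem => ?_⟩
    have h1 : a τ - b τ = 0 := hUab τ hτ fun y hy =>
      ⟨(hmem y hy).1.1, (hmem y hy).2, hVB ⟨(hmem y hy).1.2, hA (hmem y hy).2⟩⟩
    rcases hg τ with h | h <;> simp [h, h1]
  · obtain ⟨V, hV, hVg⟩ := mem_nhdsWithin_iff_exists_mem_nhds_inter.1 h
    refine ⟨V, hV, fun τ hτ hmem => ?_⟩
    cases τ with
    | nil => exact h0 hτ.symm
    | cons y τ =>
      have h2 := hmem y (by simp)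
      have h3 : g (y :: τ) = a (y :: τ) := hVg ⟨h2.1, hA h2.2⟩ τ
      rw [Pi.sub_apply, h3, sub_self]

lemma mem_locallyZero_of_cover {S A B : Set X} {j : ℕ} {f : List X → k} (hj : j ≠ 0)
    (hA : f ∈ locallyZero k A j) (hB : f ∈ locallyZero k B j)
    (h : ∀ x ∈ S, A ∈ 𝓝[S] x ∨ B ∈ 𝓝[S] x) : f ∈ locallyZero k S j := by
  refine ⟨fun x hx => ?_, fun h => absurd h hj⟩
  rcases h x hx with h | h
  · obtain ⟨V, hV, hVA⟩ := mem_nhdsWithin_iff_exists_mem_nhds_inter.1 h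
    obtain ⟨U, hU, hUf⟩ := hA.1 x (hVA ⟨mem_of_mem_nhds hV, hx⟩)
    exact ⟨U ∩ V, Filter.inter_mem hU hV, fun τ hτ hmem => hUf τ hτ fun y hy =>
      ⟨(hmem y hy).1.1, hVA ⟨(hmem y hy).1.2, (hmem y hy).2⟩⟩⟩
  · obtain ⟨V, hV, hVA⟩ := mem_nhdsWithin_iff_exists_mem_nhds_inter.1 h
    obtain ⟨U, hU, hUf⟩ := hB.1 x (hVA ⟨mem_of_mem_nhds hV, hx⟩)
    exact ⟨U ∩ V, Filter.inter_mem hU hV, fun τ hτ hmem => hUf τ hτ fun y hy =>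
      ⟨(hmem y hy).1.1, hVA ⟨(hmem y hy).1.2, (hmem y hy).2⟩⟩⟩

/-- Gluing primitives over a cover by two sets whose difference is a coboundary on the
intersection. -/
lemma exists_coboundary_of_cover {S A B : Set X} {P : X → Prop} (hA : A ⊆ S) (hB : B ⊆ S)
    (hPA : ∀ x ∈ S, (∃ᶠ y in 𝓝[S] x, P y) → A ∈ 𝓝[S] x)
    (hPB : ∀ x ∈ S, (∃ᶠ y in 𝓝[S] x, ¬ P y) → B ∈ 𝓝[S] x)
    {j : ℕ} {f a b c : List X → k} (ha : f - coboundary a ∈ locallyZero k A (j + 1))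
    (hb : f - coboundary b ∈ locallyZero k B (j + 1))
    (hc : a - b - coboundary c ∈ locallyZero k (A ∩ B) j) :
    ∃ g, f - coboundary g ∈ locallyZero k S (j + 1) := by
  classical
  let g : List X → k := fun τ =>
    if ∃ y ∈ τ.head?, P y then (a - coboundary c) τ else b τ
  have hg : ∀ τ, g τ = (a - coboundary c) τ ∨ g τ = b τ := fun τ => ite_eq_or_eq _ _ _
  have hP : ∀ y τ, P y → g (y :: τ) = (a - coboundary c) (y :: τ) := fun y τ h => by
    simp [g, h]
  have hnP : ∀ y τ, ¬ P y → g (y :: τ) = b (y :: τ) := fun y τ h => by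
    simp [g, h]
  have hac : a - coboundary c - b ∈ locallyZero k (A ∩ B) j := by
    convert hc using 1
    abel
  have h1 : a - coboundary c - g ∈ locallyZero k A j :=
    sub_mem_locallyZero_of_glue hA hac hg fun x hx => by
      by_cases h : ∃ᶠ y in 𝓝[S] x, ¬ P y
      · exact Or.inl (hPB x (hA hx) h)
      · simp only [Filter.not_frequently, not_not] at h
        exact Or.inr (h.mono fun y hy τ => hP y τ hy)
  have h2 : b - g ∈ locallyZero k B j := by
    refine sub_mem_locallyZero_of_glue (B := A) hB ?_ (fun τ => (hg τ).symm) fun x hx => ?_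
    · rw [Set.inter_comm, ← neg_sub]
      exact neg_mem hac
    · by_cases h : ∃ᶠ y in 𝓝[S] x, P y
      · exact Or.inl (hPA x (hB hx) h)
      · rw [Filter.not_frequently] at h
        exact Or.inr (h.mono fun y hy τ => hnP y τ hy)
  refine ⟨g, mem_locallyZero_of_cover (A := A) (B := B) j.succ_ne_zero ?_ ?_ fun x hx => ?_⟩
  · convert add_mem ha (coboundary_mem_locallyZero h1) using 1
    rw [map_sub, map_sub, coboundary_coboundary]
    abel
  · convert add_mem hb (coboundary_mem_locallyZero h2) using 1
    rw [map_sub]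
    abel
  · by_cases h : ∃ᶠ y in 𝓝[S] x, P y
    · exact Or.inl (hPA x hx h)
    · rw [Filter.not_frequently] at h
      have : (𝓝[S] x).NeBot := mem_closure_iff_nhdsWithin_neBot.1 (subset_closure hx)
      exact Or.inr (hPB x hx h.frequently)

end LocallyZero
end AlexanderSpanier

namespace AlexanderSpanier

section Spheres

variable {k V : Type*} [Field k] [NormedAddCommGroup V] [InnerProductSpace ℝ V]

/-- The unit sphere of a subspace. -/
def unitSphere (W : Submodule ℝ V) : Set V := {x | x ∈ W ∧ ‖x‖ = 1}

lemma normalize_mem_unitSphere {W : Submodule ℝ V} {x : V} (hx : x ∈ W) (h0 : x ≠ 0) :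
    ‖x‖⁻¹ • x ∈ unitSphere W :=
  ⟨W.smul_mem _ hx, norm_smul_inv_norm (𝕜 := ℝ) h0⟩

lemma isCompact_unitSphere_inter [FiniteDimensional ℝ V]
    (W : Submodule ℝ V) {C : Set V} (hC : IsClosed C) :
    IsCompact (unitSphere W ∩ C) := by
  have h : unitSphere W ∩ C = Metric.sphere 0 1 ∩ (W ∩ C) := by
    ext x
    simp [unitSphere]
    tauto
  rw [h]
  exact (isCompact_sphere 0 1).inter_right ((Submodule.closed_of_finiteDimensional W).inter hC)

lemma exists_coboundary_on_cap [FiniteDimensional ℝ V]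
    {W : Submodule ℝ V} {v : V} (hv : v ∈ unitSphere W) {j : ℕ}
    {f : List V → k} (hf : coboundary f ∈ locallyZero k (unitSphere W) (j + 1)) :
    ∃ g, f - coboundary g ∈
      locallyZero k (unitSphere W ∩ {x | -(1 / 2) ≤ inner ℝ v x}) j := by
  have hne : ∀ t ∈ Set.Icc (0 : ℝ) 1, ∀ x ∈ unitSphere W ∩ {x | -(1 / 2) ≤ inner ℝ v x},
      (1 - t) • x + t • v ≠ 0 := by
    rintro t ⟨ht0, ht1⟩ x ⟨⟨-, hx1⟩, hx⟩ h
    have h1 : inner ℝ v ((1 - t) • x + t • v) = 0 := by rw [h, inner_zero_right]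
    rw [inner_add_right, inner_smul_right, inner_smul_right, real_inner_self_eq_norm_sq,
      hv.2] at h1
    have h2 : ‖(1 - t) • x‖ = ‖t • v‖ := by rw [eq_neg_of_add_eq_zero_left h, norm_neg]
    rw [norm_smul, norm_smul, hx1, hv.2, Real.norm_of_nonneg ht0,
      Real.norm_of_nonneg (by linarith)] at h2
    simp only [Set.mem_ofPred_eq] at hx
    nlinarith
  refine exists_coboundary_of_contraction
    (isCompact_unitSphere_inter W (isClosed_le (by fun_prop) (by fun_prop)))
    (H := fun t x => ‖(1 - t) • x + t • v‖⁻¹ • ((1 - t) • x + t • v))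
    ?_ (fun t ht x hx => ?_) hv (fun x hx => ?_) (fun x hx => ?_) hf
  · have h : Continuous fun q : ℝ × V => (1 - q.1) • q.2 + q.1 • v := by fun_prop
    exact ContinuousOn.smul (h.norm.continuousOn.inv₀ fun q hq =>
      norm_ne_zero_iff.2 (hne q.1 hq.1 q.2 hq.2)) h.continuousOn
  · exact normalize_mem_unitSphere
      (W.add_mem (W.smul_mem _ hx.1.1) (W.smul_mem _ hv.1)) (hne t ht x hx)
  · simp [hx.1.2]
  · simp [hv.2]

lemma exists_coboundary_on_band [FiniteDimensional ℝ V]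
    {W W' : Submodule ℝ V} {v : V} (hv : v ∈ unitSphere W)
    (hW : ∀ x, x ∈ W' ↔ x ∈ W ∧ inner ℝ v x = 0) {j : ℕ} {f g : List V → k}
    (hf : coboundary f ∈
      locallyZero k (unitSphere W ∩ {x | |inner ℝ v x| ≤ 1 / 2}) (j + 1))
    (hg : f - coboundary g ∈ locallyZero k (unitSphere W') j) :
    ∃ g', f - coboundary g' ∈
      locallyZero k (unitSphere W ∩ {x | |inner ℝ v x| ≤ 1 / 2}) j := by
  set D := unitSphere W ∩ {x | |inner ℝ v x| ≤ 1 / 2} with hD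
  let y : ℝ → V → V := fun t x => x - (t * inner ℝ v x) • v
  have hyW : ∀ t, ∀ x ∈ D, y t x ∈ W := fun t x hx => W.sub_mem hx.1.1 (W.smul_mem _ hv.1)
  have hinner : ∀ t x, inner ℝ v (y t x) = (1 - t) * inner ℝ v x := fun t x => by
    rw [inner_sub_right, inner_smul_right, real_inner_self_eq_norm_sq, hv.2]
    ring
  have hnorm : ∀ t, ∀ x ∈ D,
      ‖y t x‖ ^ 2 = 1 - inner ℝ v x ^ 2 + ((1 - t) * inner ℝ v x) ^ 2 := fun t x hx => by
    rw [norm_sub_sq_real, hx.1.2, inner_smul_right, real_inner_comm, norm_smul, hv.2, mul_one,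
      Real.norm_eq_abs, sq_abs]
    ring
  have hsq : ∀ x ∈ D, inner ℝ v x ^ 2 ≤ 1 / 4 := fun x hx => by
    have hx' : |inner ℝ v x| ≤ 1 / 2 := hx.2
    have := sq_le_sq' (abs_le.1 hx').1 (abs_le.1 hx').2
    linarith
  have hne : ∀ t, ∀ x ∈ D, y t x ≠ 0 := fun t x hx h => by
    have h1 := hnorm t x hx
    rw [h, norm_zero] at h1
    nlinarith [hsq x hx, sq_nonneg ((1 - t) * inner ℝ v x)]
  have hcont : Continuous fun q : ℝ × V => y q.1 q.2 := by
    simp only [y]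
    fun_prop
  have hH : ContinuousOn (Function.uncurry fun t x => ‖y t x‖⁻¹ • y t x)
      (Set.Icc 0 1 ×ˢ D) :=
    ContinuousOn.smul (hcont.norm.continuousOn.inv₀ fun q hq =>
      norm_ne_zero_iff.2 (hne q.1 q.2 hq.2)) hcont.continuousOn
  have hmaps : ∀ t ∈ Set.Icc (0 : ℝ) 1, Set.MapsTo (fun x => ‖y t x‖⁻¹ • y t x) D D := by
    intro t ht x hx
    refine ⟨normalize_mem_unitSphere (hyW t x hx) (hne t x hx), ?_⟩
    have hpos : 0 < ‖y t x‖ := norm_pos_iff.2 (hne t x hx)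
    rw [Set.mem_ofPred_eq, inner_smul_right, hinner, abs_mul, abs_inv, abs_norm,
      inv_mul_le_iff₀ hpos]
    refine abs_le_of_sq_le_sq ?_ (by positivity)
    rw [mul_pow, mul_pow, hnorm t x hx, mul_pow]
    have h1 := hsq x hx
    have h2 : (1 - t) ^ 2 ≤ 1 := by nlinarith [ht.1, ht.2]
    nlinarith [mul_le_mul h2 h1 (sq_nonneg _) zero_le_one]
  have hmaps1 : Set.MapsTo (fun x => ‖y 1 x‖⁻¹ • y 1 x) D (unitSphere W') := by
    intro x hx
    refine normalize_mem_unitSphere ((hW _).2 ⟨hyW 1 x hx, ?_⟩) (hne 1 x hx)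
    rw [hinner, sub_self, zero_mul]
  obtain ⟨g₁, hg₁⟩ := pullback_homotopy
    (isCompact_unitSphere_inter W (isClosed_le (by fun_prop) (by fun_prop))) hH hmaps hf
  have h1 : ContinuousOn (fun x => ‖y 1 x‖⁻¹ • y 1 x) D :=
    hH.comp (f := fun x => ((1 : ℝ), x)) (by fun_prop)
      fun x hx => ⟨Set.right_mem_Icc.2 zero_le_one, hx⟩
  have h2 := pullback_mem_locallyZero h1 hmaps1 hg
  have h3 := pullback_congr (A := D) (φ := fun x => ‖y 0 x‖⁻¹ • y 0 x) (ψ := fun x => x)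
    (fun x hx => by simp [y, hx.1.2]) (j := j) f
  refine ⟨pullback (fun x => ‖y 1 x‖⁻¹ • y 1 x) g + g₁, ?_⟩
  convert sub_mem (add_mem hg₁ h2) h3 using 1
  rw [map_sub, map_add, coboundary_pullback, pullback_id]
  abel

lemma exists_primitives_on_caps [FiniteDimensional ℝ V]
    {W : Submodule ℝ V} {v : V} (hv : v ∈ unitSphere W) {j : ℕ}
    {f : List V → k} (hf : coboundary f ∈ locallyZero k (unitSphere W) (j + 2)) :
    ∃ a b, coboundary (a - b) ∈
        locallyZero k (unitSphere W ∩ {x | |inner ℝ v x| ≤ 1 / 2}) (j + 1) ∧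
      f - coboundary a ∈
        locallyZero k (unitSphere W ∩ {x | -(1 / 2) ≤ inner ℝ v x}) (j + 1) ∧
      f - coboundary b ∈
        locallyZero k (unitSphere W ∩ {x | -(1 / 2) ≤ inner ℝ (-v) x}) (j + 1) := by
  obtain ⟨a, ha⟩ := exists_coboundary_on_cap hv hf
  obtain ⟨b, hb⟩ := exists_coboundary_on_cap (v := -v) ⟨W.neg_mem hv.1, by simp [hv.2]⟩ hf
  refine ⟨a, b, ?_, ha, hb⟩
  convert sub_mem (locallyZero_anti _ _ hb) (locallyZero_anti _ _ ha) using 1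
  · rw [map_sub]
    abel
  · rintro x ⟨hx, hx'⟩
    refine ⟨hx, ?_⟩
    simp only [Set.mem_ofPred_eq, inner_neg_left] at hx' ⊢
    linarith [(abs_le.1 hx').2]
  · rintro x ⟨hx, hx'⟩
    rw [Set.mem_ofPred_eq] at hx'
    exact ⟨hx, (abs_le.1 hx').1⟩

lemma exists_coboundary_of_band {W : Submodule ℝ V} {v : V} {j : ℕ} {f a b c : List V → k}
    (ha : f - coboundary a ∈
      locallyZero k (unitSphere W ∩ {x | -(1 / 2) ≤ inner ℝ v x}) (j + 1))
    (hb : f - coboundary b ∈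
      locallyZero k (unitSphere W ∩ {x | -(1 / 2) ≤ inner ℝ (-v) x}) (j + 1))
    (hc : a - b - coboundary c ∈
      locallyZero k (unitSphere W ∩ {x | |inner ℝ v x| ≤ 1 / 2}) j) :
    ∃ g, f - coboundary g ∈ locallyZero k (unitSphere W) (j + 1) := by
  have hcap : ∀ w : V, ∀ x, ¬ (inner ℝ w x < (0 : ℝ)) →
      unitSphere W ∩ {x | -(1 / 2) ≤ inner ℝ w x} ∈ 𝓝[unitSphere W] x := fun w x hx => by
    have h1 : ∀ᶠ y in 𝓝 x, -(1 / 2) < inner ℝ w y :=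
      (show Continuous fun y : V => inner ℝ w y by fun_prop).continuousAt.eventually_const_lt
        (by linarith)
    filter_upwards [self_mem_nhdsWithin, nhdsWithin_le_nhds h1] with y hy hy'
    exact ⟨hy, hy'.le⟩
  refine exists_coboundary_of_cover (P := fun x => 0 ≤ inner ℝ v x) Set.inter_subset_left
    Set.inter_subset_left (fun x _ h => hcap v x fun h' => h ?_)
    (fun x _ h => hcap (-v) x fun h' => h ?_) ha hb (locallyZero_anti ?_ _ hc)
  · have h1 : ∀ᶠ y in 𝓝 x, inner ℝ v y < 0 :=
      (show Continuous fun y : V => inner ℝ v y by fun_prop).continuousAt.eventually_lt_const h'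
    exact nhdsWithin_le_nhds (h1.mono fun y hy => not_le.2 hy)
  · have h1 : ∀ᶠ y in 𝓝 x, inner ℝ (-v) y < 0 :=
      (show Continuous fun y : V => inner ℝ (-v) y by fun_prop).continuousAt.eventually_lt_const h'
    refine nhdsWithin_le_nhds (h1.mono fun y hy => not_not.2 ?_)
    rw [inner_neg_left] at hy
    linarith
  · rintro x ⟨⟨hx, hx1⟩, -, hx2⟩
    simp only [Set.mem_ofPred_eq, inner_neg_left] at hx1 hx2
    exact ⟨hx, abs_le.2 ⟨hx1, by linarith⟩⟩

variable (k) in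
/-- The reduced cohomology of the unit sphere of `W` vanishes outside degree `d`,
where it is at most one-dimensional. -/
def IsCohomologySphere (W : Submodule ℝ V) (d : ℕ) : Prop :=
  (∀ j, j ≠ d → ExactAt k (unitSphere W) j) ∧ RankLEOneAt k (unitSphere W) d

lemma isCohomologySphere_bot : IsCohomologySphere k (⊥ : Submodule ℝ V) 0 := by
  have h0 : ∀ x, x ∉ unitSphere (⊥ : Submodule ℝ V) := by
    rintro x ⟨hx, hx'⟩
    rw [(Submodule.mem_bot ℝ).1 hx, norm_zero] at hx'
    exact zero_ne_one hx'
  refine ⟨fun j hj f _ => ⟨0, fun x hx => absurd hx (h0 x), fun h => absurd h hj⟩,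
    fun f₁ f₂ _ _ => ?_⟩
  by_cases hf : f₁ [] = 0
  · exact ⟨1, 0, by simp, 0, fun x hx => absurd hx (h0 x), fun _ => by simp [hf]⟩
  · exact ⟨-f₂ [], f₁ [], Or.inr hf, 0, fun x hx => absurd hx (h0 x),
      fun _ => by simp [mul_comm]⟩

lemma IsCohomologySphere.succ [FiniteDimensional ℝ V]
    {W W' : Submodule ℝ V} {d : ℕ} (h : IsCohomologySphere k W' d)
    {v : V} (hv : v ∈ unitSphere W) (hW : ∀ x, x ∈ W' ↔ x ∈ W ∧ inner ℝ v x = 0) :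
    IsCohomologySphere k W (d + 1) := by
  have hsub : unitSphere W' ⊆ unitSphere W ∩ {x | |inner ℝ v x| ≤ 1 / 2} := by
    rintro x ⟨hx, hx'⟩
    exact ⟨⟨((hW x).1 hx).1, hx'⟩, by simp [((hW x).1 hx).2]⟩
  refine ⟨fun j hj f hf => ?_, fun f₁ f₂ hf₁ hf₂ => ?_⟩
  · cases j with
    | zero =>
      obtain ⟨U, hU, hfU⟩ := hf.1 v hv
      have h1 : coboundary f [v] = 0 := hfU [v] rfl fun y hy => by
        rw [List.mem_singleton.1 hy]
        exact ⟨mem_of_mem_nhds hU, hv⟩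
      rw [coboundary_cons, coboundary_nil, sub_zero] at h1
      refine ⟨0, mem_locallyZero_of_forall fun τ hτ => ?_⟩
      rw [List.length_eq_zero_iff.1 hτ]
      simp [h1]
    | succ j =>
      obtain ⟨a, b, hab, ha, hb⟩ := exists_primitives_on_caps hv hf
      obtain ⟨g, hg⟩ := h.1 j (by omega) (a - b) (locallyZero_anti hsub _ hab)
      obtain ⟨c, hc⟩ := exists_coboundary_on_band hv hW hab hg
      exact exists_coboundary_of_band ha hb hc
  · obtain ⟨a₁, b₁, hab₁, ha₁, hb₁⟩ := exists_primitives_on_caps hv hf₁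
    obtain ⟨a₂, b₂, hab₂, ha₂, hb₂⟩ := exists_primitives_on_caps hv hf₂
    obtain ⟨c₁, c₂, hne, g, hg⟩ := h.2 (a₁ - b₁) (a₂ - b₂) (locallyZero_anti hsub _ hab₁)
      (locallyZero_anti hsub _ hab₂)
    have key : ∀ x₁ x₂ y₁ y₂ : List V → k, c₁ • x₁ + c₂ • x₂ - coboundary (c₁ • y₁ + c₂ • y₂) =
        c₁ • (x₁ - coboundary y₁) + c₂ • (x₂ - coboundary y₂) := fun x₁ x₂ y₁ y₂ => by
      rw [map_add, map_smul, map_smul]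
      module
    have habc : c₁ • (a₁ - b₁) + c₂ • (a₂ - b₂) = (c₁ • a₁ + c₂ • a₂) - (c₁ • b₁ + c₂ • b₂) := by
      module
    obtain ⟨c, hc⟩ := exists_coboundary_on_band hv hW (by
      rw [map_add, map_smul, map_smul]
      exact add_mem (Submodule.smul_mem _ _ hab₁) (Submodule.smul_mem _ _ hab₂)) hg
    rw [habc] at hc
    refine ⟨c₁, c₂, hne, exists_coboundary_of_band ?_ ?_ hc⟩
    · rw [key]
      exact add_mem (Submodule.smul_mem _ _ ha₁) (Submodule.smul_mem _ _ ha₂)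
    · rw [key]
      exact add_mem (Submodule.smul_mem _ _ hb₁) (Submodule.smul_mem _ _ hb₂)

lemma isCohomologySphere_finrank [FiniteDimensional ℝ V]
    {d : ℕ} (W : Submodule ℝ V) (hW : Module.finrank ℝ W = d) :
    IsCohomologySphere k W d := by
  induction d generalizing W with
  | zero =>
    rw [Submodule.finrank_eq_zero.1 hW]
    exact isCohomologySphere_bot
  | succ d ih =>
    have hne : W ≠ ⊥ := by
      rintro rfl
      simp at hW
    obtain ⟨w, hw, hw0⟩ := W.exists_mem_ne_zero_of_ne_bot hne
    have hv := normalize_mem_unitSphere hw hw0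
    set v := ‖w‖⁻¹ • w
    have h1 := Submodule.finrank_add_inf_finrank_orthogonal
      ((Submodule.span_singleton_le_iff_mem v W).2 hv.1)
    rw [finrank_span_singleton (by
      rintro h
      have := hv.2
      rw [h, norm_zero] at this
      exact zero_ne_one this), hW] at h1
    refine (ih ((ℝ ∙ v)ᗮ ⊓ W) (by omega)).succ hv fun x => ?_
    rw [Submodule.mem_inf, Submodule.mem_orthogonal_singleton_iff_inner_right, and_comm]

end Spheres

end AlexanderSpanier

namespace AlexanderSpanier

section Transfer

variable {X Y k : Type*} [TopologicalSpace X] [TopologicalSpace Y] [Field k]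

lemma ExactAt.of_retraction {A : Set Y} {ι : X → Y} {r : Y → X} (hι : Continuous ι)
    (hιA : ∀ x, ι x ∈ A) (hr : ContinuousOn r A) (h : ∀ x, r (ι x) = x) {j : ℕ}
    (hA : ExactAt k A j) : ExactAt k (Set.univ : Set X) j := by
  intro f hf
  obtain ⟨g, hg⟩ := hA (pullback r f) (by
    rw [coboundary_pullback]
    exact pullback_mem_locallyZero hr (Set.mapsTo_univ r A) hf)
  refine ⟨pullback ι g, ?_⟩
  have := pullback_mem_locallyZero (A := Set.univ) hι.continuousOn (fun x _ => hιA x) hg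
  rwa [map_sub, pullback_pullback_eq_self h, ← coboundary_pullback] at this

lemma RankLEOneAt.of_retraction {A : Set Y} {ι : X → Y} {r : Y → X} (hι : Continuous ι)
    (hιA : ∀ x, ι x ∈ A) (hr : ContinuousOn r A) (h : ∀ x, r (ι x) = x) {j : ℕ}
    (hA : RankLEOneAt k A j) : RankLEOneAt k (Set.univ : Set X) j := by
  intro f₁ f₂ hf₁ hf₂
  have hf : ∀ f : List X → k, coboundary f ∈ locallyZero k Set.univ (j + 1) →
      coboundary (pullback r f) ∈ locallyZero k A (j + 1) := fun f hf => by
    rw [coboundary_pullback]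
    exact pullback_mem_locallyZero hr (Set.mapsTo_univ r A) hf
  obtain ⟨c₁, c₂, hc, g, hg⟩ := hA _ _ (hf f₁ hf₁) (hf f₂ hf₂)
  refine ⟨c₁, c₂, hc, pullback ι g, ?_⟩
  have := pullback_mem_locallyZero (A := Set.univ) hι.continuousOn (fun x _ => hιA x) hg
  rwa [map_sub, map_add, map_smul, map_smul, pullback_pullback_eq_self h,
    pullback_pullback_eq_self h, ← coboundary_pullback] at this

lemma sphere_cohomology {V : Type*} [NormedAddCommGroup V] [InnerProductSpace ℝ V]
    [FiniteDimensional ℝ V] [Nontrivial V] :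
    (∀ j, j ≠ Module.finrank ℝ V →
      ExactAt k (Set.univ : Set (Metric.sphere (0 : V) 1)) j) ∧
    RankLEOneAt k (Set.univ : Set (Metric.sphere (0 : V) 1)) (Module.finrank ℝ V) := by
  classical
  have h := isCohomologySphere_finrank (k := k) (⊤ : Submodule ℝ V) (finrank_top ℝ V)
  obtain ⟨x₀⟩ : Nonempty (Metric.sphere (0 : V) 1) :=
    (NormedSpace.sphere_nonempty.2 zero_le_one).to_subtype
  have hmem : ∀ {x : V}, x ∈ unitSphere (⊤ : Submodule ℝ V) ↔ x ∈ Metric.sphere (0 : V) 1 := by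
    simp [unitSphere]
  let r : V → Metric.sphere (0 : V) 1 := fun x => if hx : x ∈ Metric.sphere (0 : V) 1 then ⟨x, hx⟩
    else x₀
  have hr : ∀ x : Metric.sphere (0 : V) 1, r x = x := fun x => dif_pos x.2
  have hrc : ContinuousOn r (unitSphere (⊤ : Submodule ℝ V)) := by
    refine continuousOn_iff_continuous_domRestrict.2 (continuous_induced_rng.2 ?_)
    refine continuous_subtype_val.congr fun x => ?_
    exact (congrArg Subtype.val (hr ⟨x, hmem.1 x.2⟩)).symm
  have hι : ∀ x : Metric.sphere (0 : V) 1, (x : V) ∈ unitSphere (⊤ : Submodule ℝ V) :=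
    fun x => hmem.2 x.2
  exact ⟨fun j hj => (h.1 j hj).of_retraction continuous_subtype_val hι hrc hr,
    h.2.of_retraction continuous_subtype_val hι hrc hr⟩

end Transfer

end AlexanderSpanier

/-! ### The periodic resolution of a cyclic group and its tensor square -/

/-- The operators `A - 1` and `N = 1 + A + ⋯ + A ^ (p - 1)` of the periodic resolution of a cyclic
group, with operators contracting the periodic complex up to `Q`. -/
structure PeriodicContraction (R : Type*) [Ring R] (Q : R) where
  /-- The differential from even degrees. -/
  diff : R
  /-- The differential from odd degrees. -/
  norm : R
  /-- The contraction from even degrees. -/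
  proj : R
  /-- The contraction from odd degrees. -/
  prim : R
  diff_mul_norm : diff * norm = 0
  norm_mul_diff : norm * diff = 0
  diff_mul_prim : diff * prim + proj * norm = Q
  norm_mul_proj : norm * proj + prim * diff = Q
  mul_norm_mul_proj : Q * (norm * proj) = norm * proj

namespace PeriodicContraction

open Finset in
/-- The contraction given by orthogonal idempotents permuted cyclically by `A`. -/
def ofCyclic {R : Type*} [Ring R] {Q : R} {p : ℕ} (A : R) (E : ℕ → R) (hA : A ^ p = 1)
    (hAE : ∀ i, A * E i = E (i + 1) * A) (hEp : E p = E 0)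
    (hEQ : ∑ i ∈ range p, E i = Q) (hQ : Q * E 0 = E 0) : PeriodicContraction R Q :=
  have hnorm : (A - 1) * ∑ i ∈ range p, A ^ i = 0 := by rw [mul_geom_sum, hA, sub_self]
  have hEA : ∀ i, E i * A ^ i = A ^ i * E 0 := fun i => by
    induction i with
    | zero => simp
    | succ i ih => rw [pow_succ', ← mul_assoc, ← hAE, mul_assoc, ih, mul_assoc]
  have hshift : ∑ i ∈ range p, E (i + 1) = ∑ i ∈ range p, E i := by
    have h := (sum_range_succ E p).symm.trans (sum_range_succ' E p)
    rw [hEp] at h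
    exact (add_right_cancel h).symm
  have hcomm : (∑ i ∈ range p, E i) * A = A * ∑ i ∈ range p, E i := by
    rw [mul_sum, sum_congr rfl fun i _ => hAE i, ← sum_mul, hshift]
  { diff := A - 1
    norm := ∑ i ∈ range p, A ^ i
    proj := E 0
    prim := -∑ i ∈ range p, E i * ∑ l ∈ range i, A ^ l
    diff_mul_norm := hnorm
    norm_mul_diff := by rw [geom_sum_mul, hA, sub_self]
    diff_mul_prim := by
      have h1 : A * ∑ i ∈ range p, E i * ∑ l ∈ range i, A ^ l =
          ∑ i ∈ range p, (E (i + 1) * ∑ l ∈ range (i + 1), A ^ l) - ∑ i ∈ range p, E i := by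
        rw [← hshift, ← sum_sub_distrib, mul_sum]
        refine sum_congr rfl fun i _ => ?_
        rw [← mul_assoc, hAE, mul_assoc, sum_range_succ', pow_zero, mul_add, mul_one,
          add_sub_cancel_right, mul_sum (f := fun l => A ^ l)]
        simp_rw [pow_succ']
      have h2 := (sum_range_succ (fun i => E i * ∑ l ∈ range i, A ^ l) p).symm.trans
        (sum_range_succ' _ p)
      simp only [range_zero, sum_empty, mul_zero, add_zero, hEp] at h2
      rw [mul_neg, sub_mul, h1, ← h2]
      rw [hEQ]
      noncomm_ring
    norm_mul_proj := by
      have h1 : ∀ i, (E i * ∑ l ∈ range i, A ^ l) * (A - 1) = A ^ i * E 0 - E i := fun i => by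
        rw [mul_assoc, geom_sum_mul, mul_sub, hEA, mul_one]
      rw [neg_mul, sum_mul (f := fun i => E i * ∑ l ∈ range i, A ^ l),
        sum_congr rfl fun i _ => h1 i, sum_sub_distrib, sum_mul, hEQ]
      abel
    mul_norm_mul_proj := by
      have h1 : Commute (∑ i ∈ range p, E i) (∑ i ∈ range p, A ^ i) :=
        Commute.sum_right _ _ _ fun i _ => Commute.pow_right hcomm i
      rw [hEQ] at h1
      rw [← mul_assoc, h1.eq, mul_assoc, hQ] }

variable {R : Type*} [Ring R] {Q : R}

/-- The differential of the periodic complex. -/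
def d (P : PeriodicContraction R Q) (i : ℕ) : R := if Even i then P.diff else P.norm

/-- The contraction of the periodic complex. -/
def s (P : PeriodicContraction R Q) (i : ℕ) : R := if Even i then P.proj else P.prim

lemma d_succ_mul_d (P : PeriodicContraction R Q) (i : ℕ) : P.d (i + 1) * P.d i = 0 := by
  by_cases h : Even i <;> simp [d, h, Nat.even_add_one, P.diff_mul_norm, P.norm_mul_diff]

lemma d_mul_s_add (P : PeriodicContraction R Q) (i : ℕ) :
    P.d i * P.s (i + 1) + P.s (i + 2) * P.d (i + 1) = Q := by
  by_cases h : Even i <;>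
    simp [d, s, h, Nat.even_add_one, P.diff_mul_prim, P.norm_mul_proj]

lemma s_one_mul_d_zero (P : PeriodicContraction R Q) :
    P.s 1 * P.d 0 = Q - P.norm * P.proj := by
  simp [d, s, ← P.norm_mul_proj]

/-- The operators of the contraction lie in `S`. -/
structure Within (P : PeriodicContraction R Q) (S : Subring R) : Prop where
  diff_mem : P.diff ∈ S
  norm_mem : P.norm ∈ S
  proj_mem : P.proj ∈ S
  prim_mem : P.prim ∈ S

lemma ofCyclic_within {p : ℕ} {A : R} {E : ℕ → R} (hA : A ^ p = 1)
    (hAE : ∀ i, A * E i = E (i + 1) * A) (hEp : E p = E 0)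
    (hEQ : ∑ i ∈ Finset.range p, E i = Q) (hQ : Q * E 0 = E 0) {S : Subring R} (hAS : A ∈ S)
    (hES : ∀ i, E i ∈ S) : (ofCyclic A E hA hAE hEp hEQ hQ).Within S where
  diff_mem := sub_mem hAS (one_mem S)
  norm_mem := show ∑ i ∈ Finset.range p, A ^ i ∈ S from sum_mem fun i _ => pow_mem hAS i
  proj_mem := hES 0
  prim_mem := neg_mem (sum_mem fun i _ => mul_mem (hES i) (sum_mem fun l _ => pow_mem hAS l))

namespace Within

variable {P P' : PeriodicContraction R Q} {S : Subring R}

lemma d_mem (h : P.Within S) (i : ℕ) : P.d i ∈ S := by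
  rw [d]
  split_ifs
  exacts [h.diff_mem, h.norm_mem]

lemma s_mem (h : P.Within S) (i : ℕ) : P.s i ∈ S := by
  rw [s]
  split_ifs
  exacts [h.proj_mem, h.prim_mem]

lemma norm_mul_proj_mem (h : P.Within S) : P.norm * P.proj ∈ S := mul_mem h.norm_mem h.proj_mem

end Within

variable {M : Type*} [AddCommGroup M] [Module R M]

/-- The differential of the tensor product of two periodic complexes. -/
def total (P P' : PeriodicContraction R Q) (w : ℕ → ℕ → M) : ℕ → ℕ → M
  | 0, 0 => 0
  | a + 1, 0 => P.d a • w a 0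
  | 0, b + 1 => P'.d b • w 0 b
  | a + 1, b + 1 => P.d a • w a (b + 1) + (-1 : ℤ) ^ (a + 1) • P'.d b • w (a + 1) b

/-- A contraction of the tensor product of two periodic complexes. -/
def contraction (P P' : PeriodicContraction R Q) (w : ℕ → ℕ → M) : ℕ → ℕ → M
  | 0, b => P.s 1 • w 1 b + P'.s (b + 1) • (P.norm * P.proj) • w 0 (b + 1)
  | a + 1, b => P.s (a + 2) • w (a + 2) b

lemma total_sub (P P' : PeriodicContraction R Q) (w w' : ℕ → ℕ → M) :
    P.total P' (w - w') = P.total P' w - P.total P' w' := by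
  funext a b
  cases a <;> cases b <;> simp [total, smul_sub]
  abel

lemma total_total {P P' : PeriodicContraction R Q} (hd : ∀ i j, Commute (P.d i) (P'.d j))
    (w : ℕ → ℕ → M) : P.total P' (P.total P' w) = 0 := by
  have h1 : ∀ (P : PeriodicContraction R Q) i (x : M), P.d (i + 1) • P.d i • x = 0 :=
    fun P i x => by rw [← mul_smul, d_succ_mul_d, zero_smul]
  have h2 : ∀ i j (x : M), P'.d j • P.d i • x = P.d i • P'.d j • x :=
    fun i j x => by rw [← mul_smul, ← mul_smul, (hd i j).eq]
  funext a b
  rcases a with _ | _ | a <;> rcases b with _ | _ | b <;>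
    simp [total, h1, h2, pow_succ, smul_comm _ (_ : ℤ)]

lemma total_contraction {P P' : PeriodicContraction R Q}
    (hds : ∀ i j, Commute (P.d i) (P'.s j)) (hsd : ∀ i j, Commute (P.s i) (P'.d j))
    (hdp : ∀ i, Commute (P.norm * P.proj) (P'.d i))
    {w : ℕ → ℕ → M} (hw : P.total P' w = 0) (h0 : w 0 0 = 0) (a b : ℕ) :
    P.total P' (P.contraction P' w) a b = Q • w a b := by
  have hQ : ∀ (P : PeriodicContraction R Q) i (x : M),
      P.d i • P.s (i + 1) • x = Q • x - P.s (i + 2) • P.d (i + 1) • x := fun P i x => by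
    rw [← mul_smul, ← mul_smul, ← sub_smul, eq_sub_of_add_eq (P.d_mul_s_add i)]
  have hsd' : ∀ i j (x : M), P'.d j • P.s i • x = P.s i • P'.d j • x :=
    fun i j x => by rw [← mul_smul, ← mul_smul, (hsd i j).eq]
  have hN : ∀ j (x : M), P.d 0 • P'.s j • (P.norm * P.proj) • x = 0 := fun j x => by
    rw [← mul_smul, (hds 0 j).eq, mul_smul, ← mul_smul (P.d 0), ← mul_assoc]
    simp [d, P.diff_mul_norm]
  have hw' := fun a b => congrFun (congrFun hw a) b
  rcases a with _ | a <;> rcases b with _ | b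
  · simp [total, h0]
  · have h1 := hw' 1 (b + 1)
    have h2 := hw' 0 (b + 2)
    simp only [total, zero_add, pow_one, neg_smul, one_smul, Pi.zero_apply,
      add_neg_eq_zero] at h1 h2
    rw [total, contraction, smul_add, hsd', ← h1, hQ, ← mul_smul (P'.d (b + 1)), ← (hdp _).eq,
      mul_smul (P.norm * P.proj), h2, smul_zero, smul_zero, sub_zero, ← mul_smul Q,
      P.mul_norm_mul_proj, ← mul_smul, s_one_mul_d_zero, sub_smul, sub_add_cancel]
  · have h1 := hw' (a + 2) 0
    simp only [total, Pi.zero_apply] at h1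
    rcases a with _ | a
    · rw [total, contraction, smul_add, hN, add_zero, hQ, h1, smul_zero, sub_zero]
    · rw [total, contraction, hQ, h1, smul_zero, sub_zero]
  · have h1 := hw' (a + 2) (b + 1)
    have h3 : P.d (a + 1) • w (a + 1) (b + 1) =
        (-1 : ℤ) ^ (a + 1) • P'.d b • w (a + 2) b := by
      simp only [total, Pi.zero_apply, pow_succ _ (a + 1), mul_neg, mul_one, neg_smul,
        add_neg_eq_zero] at h1
      exact h1
    have h4 : P.total P' (P.contraction P' w) (a + 1) (b + 1) =
        P.d a • P.s (a + 1) • w (a + 1) (b + 1) +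
          (-1 : ℤ) ^ (a + 1) • P'.d b • P.s (a + 2) • w (a + 2) b := by
      rcases a with _ | a
      · rw [total, contraction, contraction, smul_add, hN, add_zero]
      · rw [total, contraction, contraction]
    rw [h4, hQ, hsd', smul_comm _ (P.s (a + 2)), ← h3, sub_add_cancel]

lemma total_mem {P P' : PeriodicContraction R Q} (S : AddSubgroup M)
    (hd : ∀ i, ∀ x ∈ S, P.d i • x ∈ S) (hd' : ∀ i, ∀ x ∈ S, P'.d i • x ∈ S)
    {w : ℕ → ℕ → M} {a b : ℕ} (hw : ∀ a' b', a' + b' + 1 = a + b → w a' b' ∈ S) :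
    P.total P' w a b ∈ S := by
  rcases a with _ | a <;> rcases b with _ | b
  · exact zero_mem S
  · exact hd' _ _ (hw _ _ (by omega))
  · exact hd _ _ (hw _ _ (by omega))
  · exact add_mem (hd _ _ (hw _ _ (by omega)))
      (zsmul_mem (hd' _ _ (hw _ _ (by omega))) _)

lemma contraction_mem {P P' : PeriodicContraction R Q} (S : AddSubgroup M)
    (hs : ∀ i, ∀ x ∈ S, P.s i • x ∈ S) (hs' : ∀ i, ∀ x ∈ S, P'.s i • x ∈ S)
    (hp : ∀ x ∈ S, (P.norm * P.proj) • x ∈ S)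
    {w : ℕ → ℕ → M} {a b : ℕ} (hw : ∀ a' b', a' + b' = a + b + 1 → w a' b' ∈ S) :
    P.contraction P' w a b ∈ S := by
  rcases a with _ | a
  · exact add_mem (hs _ _ (hw _ _ (by omega))) (hs' _ _ (hp _ (hw _ _ (by omega))))
  · exact hs _ _ (hw _ _ (by omega))

lemma total_map {P P' : PeriodicContraction R Q} (f : M →+ M)
    (hd : ∀ i x, f (P.d i • x) = P.d i • f x) (hd' : ∀ i x, f (P'.d i • x) = P'.d i • f x)
    (w : ℕ → ℕ → M) :
    P.total P' (fun a b => f (w a b)) = fun a b => f (P.total P' w a b) := by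
  funext a b
  rcases a with _ | a <;> rcases b with _ | b <;> simp [total, hd, hd']

lemma map_contraction_sub_mem {P P' : PeriodicContraction R Q} (S : AddSubgroup M) (f : M →+ M)
    (hs : ∀ i x, f (P.s i • x) - P.s i • f x ∈ S)
    (hs' : ∀ i x, f ((P'.s i * (P.norm * P.proj)) • x) -
      (P'.s i * (P.norm * P.proj)) • f x ∈ S) (w : ℕ → ℕ → M) (a b : ℕ) :
    f (P.contraction P' w a b) - P.contraction P' (fun a b => f (w a b)) a b ∈ S := by
  rcases a with _ | a
  · simp only [contraction, map_add, add_sub_add_comm, ← mul_smul (P'.s _)]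
    exact add_mem (hs _ _) (hs' _ _)
  · exact hs _ _

end PeriodicContraction

namespace AlexanderSpanier

section Operators

variable {X k : Type*} [Field k]

/-- Multiplication by a function of the first point. -/
def headMul (e : X → k) : Module.End k (List X → k) where
  toFun f
    | [] => 0
    | x :: τ => e x * f (x :: τ)
  map_add' f g := by
    funext τ
    cases τ <;> simp [mul_add]
  map_smul' c f := by
    funext τ
    cases τ <;> simp [mul_left_comm]

@[simp] lemma headMul_nil (e : X → k) (f : List X → k) : headMul e f [] = 0 := rfl

@[simp] lemma headMul_cons (e : X → k) (f : List X → k) (x : X) (τ : List X) :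
    headMul e f (x :: τ) = e x * f (x :: τ) := rfl

lemma headMul_one_apply {f : List X → k} (hf : f [] = 0) : headMul (fun _ => 1) f = f := by
  funext τ
  cases τ <;> simp [hf]

lemma headMul_mul_headMul (e e' : X → k) :
    headMul e * headMul e' = headMul fun x => e x * e' x := by
  ext f τ
  cases τ <;> simp [mul_assoc]

lemma commute_headMul (e e' : X → k) : Commute (headMul e) (headMul e') := by
  rw [Commute, SemiconjBy, headMul_mul_headMul, headMul_mul_headMul]
  simp only [mul_comm]

lemma sum_headMul {ι : Type*} (s : Finset ι) (e : ι → X → k) :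
    ∑ i ∈ s, headMul (e i) = headMul fun x => ∑ i ∈ s, e i x := by
  ext f τ
  cases τ <;> simp [Finset.sum_mul]

/-- The pullback along a self-map, as an endomorphism. -/
def pullbackEnd (φ : X → X) : Module.End k (List X → k) := pullback φ

lemma pullbackEnd_apply (φ : X → X) (f : List X → k) (τ : List X) :
    pullbackEnd φ f τ = f (τ.map φ) := rfl

lemma pullbackEnd_mul (φ ψ : X → X) :
    (pullbackEnd φ * pullbackEnd ψ : Module.End k (List X → k)) = pullbackEnd (ψ ∘ φ) := by
  ext f τ
  simp [pullbackEnd_apply]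

lemma pullbackEnd_pow (φ : X → X) (n : ℕ) :
    (pullbackEnd φ ^ n : Module.End k (List X → k)) = pullbackEnd φ^[n] := by
  induction n with
  | zero =>
    ext f τ
    simp [pullbackEnd_apply]
  | succ n ih => rw [pow_succ', ih, pullbackEnd_mul, Function.iterate_succ]

lemma pullbackEnd_mul_headMul (φ : X → X) (e : X → k) :
    pullbackEnd φ * headMul e = headMul (e ∘ φ) * pullbackEnd φ := by
  ext f τ
  cases τ <;> simp [pullbackEnd_apply]

lemma coboundary_headMul (e : X → k) (f : List X → k) (x y : X) (τ : List X) :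
    coboundary (headMul e f) (x :: y :: τ) - headMul e (coboundary f) (x :: y :: τ) =
      (e y - e x) * f (y :: τ) := by
  have h : (fun σ => headMul e f (x :: σ)) = e x • fun σ => f (x :: σ) := rfl
  rw [coboundary_cons _ x, h, map_smul, headMul_cons e (coboundary f), coboundary_cons f x]
  simp only [headMul_cons, Pi.smul_apply, smul_eq_mul]
  ring

end Operators

section LocalOperators

variable {X k : Type*} [TopologicalSpace X] [Field k]

variable (k) in
/-- The operators preserving locally zero cochains on `U` and commuting with the coboundary up to
such cochains. -/
def localOperators (U : Set X) : Subring (Module.End k (List X → k)) where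
  carrier := {O | (∀ j, ∀ f ∈ locallyZero k U j, O f ∈ locallyZero k U j) ∧
    ∀ f j, 2 ≤ j → coboundary (O f) - O (coboundary f) ∈ locallyZero k U j}
  zero_mem' := ⟨fun _ _ _ => zero_mem _, fun _ _ _ => by simp⟩
  one_mem' := ⟨fun _ _ hf => hf, fun _ _ _ => by simp⟩
  add_mem' := by
    rintro O O' ⟨h1, h2⟩ ⟨h1', h2'⟩
    refine ⟨fun j f hf => add_mem (h1 j f hf) (h1' j f hf), fun f j hj => ?_⟩
    rw [LinearMap.add_apply, LinearMap.add_apply, map_add, add_sub_add_comm]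
    exact add_mem (h2 f j hj) (h2' f j hj)
  neg_mem' := by
    rintro O ⟨h1, h2⟩
    refine ⟨fun j f hf => neg_mem (h1 j f hf), fun f j hj => ?_⟩
    rw [LinearMap.neg_apply, LinearMap.neg_apply, map_neg, ← neg_sub']
    exact neg_mem (h2 f j hj)
  mul_mem' := by
    rintro O O' ⟨h1, h2⟩ ⟨h1', h2'⟩
    refine ⟨fun j f hf => h1 j _ (h1' j f hf), fun f j hj => ?_⟩
    rw [Module.End.mul_apply, Module.End.mul_apply,
      ← sub_add_sub_cancel _ (O (coboundary (O' f))), ← map_sub]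
    exact add_mem (h2 _ j hj) (h1 j _ (h2' f j hj))

variable (k) in
/-- The operators preserving locally zero cochains on `U`. -/
def preservingOperators (U : Set X) : Subring (Module.End k (List X → k)) where
  carrier := {O | ∀ j, ∀ f ∈ locallyZero k U j, O f ∈ locallyZero k U j}
  zero_mem' := fun _ _ _ => zero_mem _
  one_mem' := fun _ _ hf => hf
  add_mem' := fun h h' j f hf => add_mem (h j f hf) (h' j f hf)
  neg_mem' := fun h j f hf => neg_mem (h j f hf)
  mul_mem' := fun h h' j f hf => h j _ (h' j f hf)

lemma headMul_mem_preservingOperators (U : Set X) (e : X → k) :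
    headMul e ∈ preservingOperators k U := by
  rintro j f ⟨hf, -⟩
  refine ⟨fun x hx => ?_, fun _ => rfl⟩
  obtain ⟨V, hV, hVf⟩ := hf x hx
  refine ⟨V, hV, fun τ hτ h => ?_⟩
  cases τ with
  | nil => rfl
  | cons y τ => rw [headMul_cons, hVf _ hτ h, mul_zero]

lemma headMul_mem_localOperators {U : Set X} {e : X → k}
    (he : ∀ x ∈ U, ∀ᶠ y in 𝓝 x, e y = e x) : headMul e ∈ localOperators k U := by
  refine ⟨headMul_mem_preservingOperators U e, fun f j hj => ⟨fun x hx => ?_, by omega⟩⟩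
  refine ⟨_, he x hx, fun τ hτ h => ?_⟩
  obtain _ | ⟨y, _ | ⟨z, τ⟩⟩ := τ
  · simp
  · simp only [List.length_singleton] at hτ
    omega
  · have hy : e y = e x := (h y (by simp)).1
    have hz : e z = e x := (h z (by simp)).1
    rw [Pi.sub_apply, coboundary_headMul, hy, hz, sub_self, zero_mul]

lemma pullbackEnd_mem_localOperators {U : Set X} {φ : X → X} (hφ : Continuous φ)
    (hU : Set.MapsTo φ U U) : pullbackEnd φ ∈ localOperators k U :=
  ⟨fun _ _ hf => pullback_mem_locallyZero hφ.continuousOn hU hf, fun f j _ => by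
    rw [show coboundary (pullbackEnd φ f) = pullbackEnd φ (coboundary f) from
      coboundary_pullback φ f, sub_self]
    exact zero_mem _⟩

lemma localOperators_le (U : Set X) : localOperators k U ≤ preservingOperators k U :=
  fun _ h => h.1

end LocalOperators

/-! ### Free actions -/

section Action

variable {X k : Type*} [Field k] {p : ℕ}

/-- A function `X → ℤ/p` that is translated by one along `φ`. -/
structure Phase (p : ℕ) (φ : X → X) where
  /-- The underlying function. -/
  toFun : X → ZMod p
  apply_map : ∀ x, toFun (φ x) = toFun x + 1

variable (k) in
/-- The indicator functions of the level sets of a phase. -/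
def Phase.level {φ : X → X} (γ : Phase p φ) (i : ℕ) : X → k :=
  fun x => if γ.toFun x + i = 0 then 1 else 0

lemma Phase.level_comp {φ : X → X} (γ : Phase p φ) (i : ℕ) :
    γ.level k i ∘ φ = γ.level k (i + 1) := by
  funext x
  simp [level, γ.apply_map, add_assoc, add_comm]

lemma Phase.sum_level [NeZero p] {φ : X → X} (γ : Phase p φ) (x : X) :
    ∑ i ∈ Finset.range p, γ.level k i x = 1 := by
  rw [Finset.sum_eq_single (-γ.toFun x).val]
  · simp [level]
  · intro i hi hne
    refine if_neg fun h => hne ?_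
    rw [← eq_neg_of_add_eq_zero_right h, ZMod.val_natCast_of_lt (Finset.mem_range.1 hi)]
  · exact fun h => absurd (Finset.mem_range.2 (ZMod.val_lt _)) h

variable (k) in
/-- The contraction of the periodic complex of a self-map of order `p` attached to a phase. -/
def Phase.contraction [NeZero p] {φ : X → X} (hφ : φ^[p] = id) (γ : Phase p φ) :
    PeriodicContraction (Module.End k (List X → k)) (headMul fun _ => 1) :=
  .ofCyclic (p := p) (pullbackEnd φ) (fun i => headMul (γ.level k i))
    (by
      rw [pullbackEnd_pow, hφ]
      ext f τ
      simp [pullbackEnd_apply])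
    (fun i => by rw [pullbackEnd_mul_headMul, γ.level_comp])
    (congrArg headMul (funext fun x => by simp [Phase.level]))
    (by simp only [sum_headMul, γ.sum_level])
    (by simp only [headMul_mul_headMul, one_mul])

end Action

end AlexanderSpanier

/-! ### Spaces with the cohomology of a sphere -/

namespace AlexanderSpanier

variable {X k : Type*} [TopologicalSpace X] [Field k]

variable (X k) in
/-- A differential on families of cochains indexed by `ℕ × ℕ`, raising the total degree by one,
local, commuting with the coboundary, and trivial on constants. -/
structure TotalDifferential where
  /-- The differential. -/
  D : (ℕ → ℕ → List X → k) → ℕ → ℕ → List X → k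
  D_sub : ∀ w w', D (w - w') = D w - D w'
  D_D : ∀ w, D (D w) = 0
  D_mem : ∀ j w a b, (∀ a' b', a' + b' + 1 = a + b → w a' b' ∈ locallyZero k Set.univ j) →
    D w a b ∈ locallyZero k Set.univ j
  D_coboundary : ∀ w, D (fun a b => coboundary (w a b)) = fun a b => coboundary (D w a b)
  D_nil : ∀ w a b, D w a b [] = 0
  D_const : ∀ u : ℕ → ℕ → k, D (fun a b _ => u a b) = 0

/-- A contraction of a total differential, compatible with the coboundary near the points of
`U`, and local with respect to the sets in a given family. -/
structure LocalContraction (T : TotalDifferential X k) (𝒰 : Set (Set X)) (U : Set X) where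
  /-- The contraction. -/
  h : (ℕ → ℕ → List X → k) → ℕ → ℕ → List X → k
  D_h : ∀ w, T.D w = 0 → w 0 0 = 0 → (∀ a b, w a b [] = 0) → T.D (h w) = w
  h_eq_zero : ∀ w a b, (∀ a' b', a' + b' = a + b + 1 → w a' b' = 0) → h w a b = 0
  h_mem : ∀ V ∈ 𝒰, ∀ j w a b, (∀ a' b', a' + b' = a + b + 1 → w a' b' ∈ locallyZero k V j) →
    h w a b ∈ locallyZero k V j
  coboundary_h_mem : ∀ w, (∀ a b, coboundary (w a b) = 0) → ∀ j, 2 ≤ j → ∀ a b,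
    coboundary (h w a b) ∈ locallyZero k U j

lemma mem_locallyZero_iUnion {ι : Type*} {U : ι → Set X} (hU : ∀ i, IsOpen (U i))
    (hcover : ∀ x, ∃ i, x ∈ U i) {j : ℕ} (hj : j ≠ 0) {f : List X → k}
    (hf : ∀ i, f ∈ locallyZero k (U i) j) : f ∈ locallyZero k Set.univ j := by
  refine ⟨fun x _ => ?_, fun h => absurd h hj⟩
  obtain ⟨i, hi⟩ := hcover x
  obtain ⟨V, hV, hVf⟩ := (hf i).1 x hi
  exact ⟨V ∩ U i, Filter.inter_mem hV ((hU i).mem_nhds hi), fun τ hτ h =>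
    hVf τ hτ fun y hy => (h y hy).1⟩

/-- The successive lifts of a family of constants. -/
def ladder {T : TotalDifferential X k} {U : ℕ → Set X}
    (H : ∀ i, LocalContraction T (Set.range U) (U i)) (u : ℕ → ℕ → k) :
    ℕ → ℕ → ℕ → List X → k
  | 0 => fun a b _ => u a b
  | i + 1 => (H i).h fun a b => coboundary (ladder H u i a b)

section Ladder

variable {T : TotalDifferential X k} {U : ℕ → Set X}
  (H : ∀ i, LocalContraction T (Set.range U) (U i)) {m : ℕ} {u : ℕ → ℕ → k}

lemma ladder_eq_zero (hu : ∀ a b, a + b ≠ m → u a b = 0) (i : ℕ) :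
    ∀ a b, a + b + i ≠ m → ladder H u i a b = 0 := by
  induction i with
  | zero => exact fun a b hab => funext fun _ => hu a b hab
  | succ i ih =>
    refine fun a b hab => (H i).h_eq_zero _ a b fun a' b' h => ?_
    simp only [ih a' b' (by omega), map_zero]

lemma D_ladder (hu : ∀ a b, a + b ≠ m → u a b = 0) (i : ℕ) (hi : i < m) :
    T.D (ladder H u (i + 1)) = fun a b => coboundary (ladder H u i a b) := by
  refine (H i).D_h _ ?_ ?_ fun a b => rfl
  · rw [T.D_coboundary]
    cases i with
    | zero =>
      rw [ladder, T.D_const]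
      simp only [Pi.zero_apply, map_zero]
      rfl
    | succ i =>
      rw [D_ladder hu i (by omega)]
      simp only [coboundary_coboundary]
      rfl
  · simp only [ladder_eq_zero H hu i 0 0 (by omega), map_zero]

lemma coboundary_ladder_mem (i : ℕ) : ∀ l < i, ∀ j, i + 1 ≤ j → ∀ a b,
    coboundary (ladder H u i a b) ∈ locallyZero k (U l) j := by
  induction i with
  | zero => exact fun l hl => absurd hl (by omega)
  | succ i ih =>
    intro l hl j hj a b
    obtain rfl | hl := eq_or_lt_of_le (Nat.lt_succ_iff.1 hl)
    · exact (H l).coboundary_h_mem _ (fun a b => coboundary_coboundary _) j (by omega) a b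
    · obtain ⟨j, rfl⟩ : ∃ j', j = j' + 1 := ⟨j - 1, by omega⟩
      exact coboundary_mem_locallyZero ((H i).h_mem _ ⟨l, rfl⟩ j _ a b fun a' b' _ =>
        ih l hl j (by omega) a' b')

lemma coboundary_ladder_mem_univ (hU : ∀ i, IsOpen (U i)) (hcover : ∀ x, ∃ i < m, x ∈ U i)
    (a b : ℕ) : coboundary (ladder H u m a b) ∈ locallyZero k Set.univ (m + 1) := by
  refine mem_locallyZero_iUnion (U := fun i : Fin m => U i) (fun i => hU i) (fun x => ?_)
    m.succ_ne_zero fun i => coboundary_ladder_mem H m i i.2 _ le_rfl a b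
  obtain ⟨i, hi, hx⟩ := hcover x
  exact ⟨⟨i, hi⟩, hx⟩

end Ladder

section Descent

variable {T : TotalDifferential X k} {x : ℕ → ℕ → ℕ → List X → k} {m : ℕ}

variable (T x m) in
/-- In total degree `m - i`, the family `x i` is a cocycle up to a total differential. -/
def IsLiftable (i : ℕ) : Prop :=
  ∃ y, ∀ a b, a + b + i = m →
    coboundary (x i a b - T.D y a b) ∈ locallyZero k Set.univ (i + 1)

lemma IsLiftable.of_primitive {i : ℕ} (hx : T.D (x (i + 1)) = fun a b => coboundary (x i a b))
    {y g : ℕ → ℕ → List X → k} (h : ∀ a b, a + b + (i + 1) = m →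
      x (i + 1) a b - T.D y a b - coboundary (g a b) ∈ locallyZero k Set.univ (i + 1)) :
    IsLiftable T x m i := by
  refine ⟨g, fun a b hab => ?_⟩
  have h1 := T.D_mem (i + 1) (x (i + 1) - T.D y - fun a b => coboundary (g a b)) a b
    fun a' b' h' => h a' b' (by omega)
  rw [T.D_sub, T.D_sub, T.D_D, T.D_coboundary, hx, sub_zero] at h1
  rw [map_sub]
  exact h1

lemma IsLiftable.exists_primitive {i : ℕ} (hexact : ExactAt k (Set.univ : Set X) i)
    (h : IsLiftable T x m i) : ∃ y g : ℕ → ℕ → List X → k, ∀ a b, a + b + i = m →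
      x i a b - T.D y a b - coboundary (g a b) ∈ locallyZero k Set.univ i := by
  obtain ⟨y, hy⟩ := h
  choose! g hg using fun a b hab => hexact _ (hy a b hab)
  exact ⟨y, g, hg⟩

lemma IsLiftable.anti {i j : ℕ} (hij : i ≤ j)
    (hexact : ∀ l, i < l → l ≤ j → ExactAt k (Set.univ : Set X) l)
    (hx : ∀ l < j, T.D (x (l + 1)) = fun a b => coboundary (x l a b))
    (h : IsLiftable T x m j) : IsLiftable T x m i := by
  induction j, hij using Nat.le_induction with
  | base => exact h
  | succ j hij ih =>
    obtain ⟨y, g, hg⟩ := h.exists_primitive (hexact _ (by omega) le_rfl)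
    exact ih (fun l h h' => hexact l h (by omega)) (fun l hl => hx l (by omega))
      (.of_primitive (hx j j.lt_succ_self) hg)

lemma IsLiftable.apply_nil (hexact : ExactAt k (Set.univ : Set X) 0) (h : IsLiftable T x m 0)
    {a b : ℕ} (hab : a + b = m) : x 0 a b [] = 0 := by
  obtain ⟨y, g, hg⟩ := h.exists_primitive hexact
  simpa [T.D_nil] using (hg a b hab).2 rfl

end Descent

lemma RankLEOneAt.exists_generator {A : Set X} {j : ℕ} (h : RankLEOneAt k A j) :
    ∃ ω, ∀ f, coboundary f ∈ locallyZero k A (j + 1) →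
      ∃ c : k, ∃ g, f - c • ω - coboundary g ∈ locallyZero k A j := by
  by_cases hA : ExactAt k A j
  · refine ⟨0, fun f hf => ⟨0, ?_⟩⟩
    simpa using hA f hf
  · simp only [ExactAt, not_forall] at hA
    obtain ⟨ω, hω, hne⟩ := hA
    refine ⟨ω, fun f hf => ?_⟩
    obtain ⟨c₁, c₂, hc, g, hg⟩ := h f ω hf hω
    have hc₁ : c₁ ≠ 0 := by
      rintro rfl
      have hc₂ : c₂ ≠ 0 := by simpa using hc
      refine hne ⟨c₂⁻¹ • g, ?_⟩
      convert Submodule.smul_mem _ c₂⁻¹ hg using 1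
      rw [map_smul, zero_smul, zero_add, smul_sub, inv_smul_smul₀ hc₂]
    refine ⟨-(c₁⁻¹ * c₂), c₁⁻¹ • g, ?_⟩
    convert Submodule.smul_mem _ c₁⁻¹ hg using 1
    rw [map_smul, smul_sub, smul_add, inv_smul_smul₀ hc₁, neg_smul, mul_smul]
    abel

/-- A space with the cohomology of an `n`-sphere carries no total differential that has local
contractions. -/
theorem not_exists_localContraction [Finite k] {n : ℕ}
    (hexact : ∀ j, j ≠ n + 1 → ExactAt k (Set.univ : Set X) j)
    (hrank : RankLEOneAt k (Set.univ : Set X) (n + 1)) {T : TotalDifferential X k} {m : ℕ}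
    (hm : n + 1 ≤ m) {U : ℕ → Set X} (hU : ∀ i, IsOpen (U i)) (hcover : ∀ x, ∃ i < m, x ∈ U i)
    (H : ∀ i, LocalContraction T (Set.range U) (U i)) : False := by
  classical
  have := Fintype.ofFinite k
  obtain ⟨ω, hω⟩ := hrank.exists_generator
  let u : (Fin (m + 1) → k) → ℕ → ℕ → k := fun v a b =>
    if h : a + b = m then v ⟨a, by omega⟩ else 0
  have hu : ∀ v a b, a + b ≠ m → u v a b = 0 := fun v a b h => dif_neg h
  have key : ∀ v, ∃ (c : Fin (m - n) → k) (y g : ℕ → ℕ → List X → k), ∀ (a b : ℕ)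
      (h : a + b + (n + 1) = m), ladder H (u v) (n + 1) a b - T.D y a b -
        c ⟨a, by omega⟩ • ω - coboundary (g a b) ∈ locallyZero k Set.univ (n + 1) := by
    intro v
    have h1 : IsLiftable T (ladder H (u v)) m m := by
      refine ⟨0, fun a b _ => ?_⟩
      have h0 : T.D 0 = 0 := by simpa using T.D_sub 0 0
      rw [h0]
      simpa using coboundary_ladder_mem_univ H hU hcover a b
    obtain ⟨y, hy⟩ := h1.anti hm (fun l hl _ => hexact l (by omega))
      fun l hl => D_ladder H (hu v) l hl
    choose! c g hcg using fun a b hab => hω _ (hy a b hab)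
    refine ⟨fun a => c a (m - (n + 1) - a), y, g, fun a b h => ?_⟩
    have hb : m - (n + 1) - a = b := by omega
    simp only [hb]
    exact hcg a b h
  choose c y g hcyg using key
  obtain ⟨v, v', hne, hc⟩ := Fintype.exists_ne_map_eq_of_card_lt c (by
    simp only [Fintype.card_fun, Fintype.card_fin]
    exact Nat.pow_lt_pow_right Fintype.one_lt_card (by omega))
  have h2 : IsLiftable T (ladder H (u v) - ladder H (u v')) m n := by
    refine .of_primitive (y := y v - y v') (g := g v - g v') ?_ fun a b hab => ?_
    · rw [Pi.sub_apply, T.D_sub, D_ladder H (hu v) n hm, D_ladder H (hu v') n hm]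
      funext a b
      simp [map_sub]
    · have h := sub_mem (hcyg v a b hab) (hcyg v' a b hab)
      rw [hc] at h
      convert h using 1
      rw [T.D_sub]
      simp only [Pi.sub_apply, map_sub]
      abel
  have h3 := h2.anti (Nat.zero_le n) (fun l _ hl => hexact l (by omega)) fun l hl => by
    rw [Pi.sub_apply, T.D_sub, D_ladder H (hu v) l (by omega), D_ladder H (hu v') l (by omega)]
    funext a b
    simp [map_sub]
  refine hne (funext fun a => ?_)
  have hab : (a : ℕ) + (m - a) = m := by omega
  have h4 := h3.apply_nil (hexact 0 (by omega)) hab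
  simpa [ladder, u, hab, sub_eq_zero] using h4

end AlexanderSpanier

namespace AlexanderSpanier

section Phase

variable {X k : Type*} [Field k] {p : ℕ} [NeZero p] {φ : X → X}

lemma Phase.contraction_within (hφ : φ^[p] = id) (γ : Phase p φ)
    {S : Subring (Module.End k (List X → k))} (hS : pullbackEnd φ ∈ S)
    (hγ : ∀ i, headMul (γ.level k i) ∈ S) : (γ.contraction k hφ).Within S :=
  PeriodicContraction.ofCyclic_within _ _ _ _ _ hS hγ

lemma Phase.contraction_d (hφ : φ^[p] = id) (γ : Phase p φ) (i : ℕ) :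
    (γ.contraction k hφ).d i =
      if Even i then pullbackEnd φ - 1 else ∑ l ∈ Finset.range p, pullbackEnd φ ^ l := rfl

lemma Phase.contraction_d_mem (hφ : φ^[p] = id) (γ : Phase p φ)
    {S : Subring (Module.End k (List X → k))} (hS : pullbackEnd φ ∈ S) (i : ℕ) :
    (γ.contraction k hφ).d i ∈ S := by
  rw [contraction_d]
  split_ifs
  exacts [sub_mem hS (one_mem S), sum_mem fun i _ => pow_mem hS i]

lemma Phase.contraction_d_apply_eq_zero [CharP k p] (hφ : φ^[p] = id) (γ : Phase p φ) (i : ℕ)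
    {f : List X → k} {τ : List X} (h : ∀ l, f (τ.map φ^[l]) = f τ) :
    (γ.contraction k hφ).d i f τ = 0 := by
  rw [contraction_d]
  split_ifs
  · have := h 1
    rw [Function.iterate_one] at this
    simp [pullbackEnd_apply, this]
  · simp [pullbackEnd_pow, pullbackEnd_apply, h]

end Phase

/-- A pair of commuting continuous self-maps of order dividing `p`. -/
structure TorusAction (p : ℕ) (X : Type*) [TopologicalSpace X] where
  /-- The first generator. -/
  φ : X → X
  /-- The second generator. -/
  ψ : X → X
  continuous_φ : Continuous φ
  continuous_ψ : Continuous ψ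
  iterate_φ : φ^[p] = id
  iterate_ψ : ψ^[p] = id
  comm : φ ∘ ψ = ψ ∘ φ

/-- An equivariant function to `ℤ/p × ℤ/p`. -/
structure TorusPhase {p : ℕ} {X : Type*} [TopologicalSpace X] (t : TorusAction p X) where
  /-- The first component. -/
  fst : Phase p t.φ
  /-- The second component. -/
  snd : Phase p t.ψ
  fst_ψ : ∀ x, fst.toFun (t.ψ x) = fst.toFun x
  snd_φ : ∀ x, snd.toFun (t.φ x) = snd.toFun x

namespace TorusPhase

variable {X k : Type*} [TopologicalSpace X] [Field k] {p : ℕ} [NeZero p] {t : TorusAction p X}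

variable (k) in
/-- The contraction for the first generator. -/
def left (γ : TorusPhase t) := γ.fst.contraction k t.iterate_φ

variable (k) in
/-- The contraction for the second generator. -/
def right (γ : TorusPhase t) := γ.snd.contraction k t.iterate_ψ

lemma left_within (γ : TorusPhase t) {S : Subring (Module.End k (List X → k))}
    (hS : pullbackEnd t.φ ∈ S) (hγ : ∀ i, headMul (γ.fst.level k i) ∈ S) : (γ.left k).Within S :=
  γ.fst.contraction_within _ hS hγ

lemma right_within (γ : TorusPhase t) {S : Subring (Module.End k (List X → k))}
    (hS : pullbackEnd t.ψ ∈ S) (hγ : ∀ i, headMul (γ.snd.level k i) ∈ S) : (γ.right k).Within S :=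
  γ.snd.contraction_within _ hS hγ

lemma commute_of_within (γ : TorusPhase t) {O O' : Module.End k (List X → k)}
    (hO : ∀ S, (γ.left k).Within S → O ∈ S) (hO' : ∀ S, (γ.right k).Within S → O' ∈ S) :
    Commute O O' := by
  have h1 : ∀ i, γ.fst.level k i ∘ t.ψ = γ.fst.level k i := fun i => by
    funext x
    simp [Phase.level, γ.fst_ψ]
  have h2 : ∀ i, γ.snd.level k i ∘ t.φ = γ.snd.level k i := fun i => by
    funext x
    simp [Phase.level, γ.snd_φ]
  have h3 : (pullbackEnd t.φ * pullbackEnd t.ψ : Module.End k (List X → k)) =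
      pullbackEnd t.ψ * pullbackEnd t.φ := by rw [pullbackEnd_mul, pullbackEnd_mul, t.comm]
  have hl : ∀ O' : Module.End k (List X → k), pullbackEnd t.φ * O' = O' * pullbackEnd t.φ →
      (∀ i, headMul (γ.fst.level k i) * O' = O' * headMul (γ.fst.level k i)) → O * O' = O' * O :=
    fun O' ha hb => (Subring.mem_centralizer_iff.1 (hO (Subring.centralizer {O'})
      (γ.left_within (Subring.mem_centralizer_iff.2 fun _ h => by rw [h, ha])
        fun i => Subring.mem_centralizer_iff.2 fun _ h => by rw [h, hb])) O' rfl).symm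
  refine Subring.mem_centralizer_iff.1 (hO' (Subring.centralizer {O}) (γ.right_within
    (Subring.mem_centralizer_iff.2 ?_) fun j => Subring.mem_centralizer_iff.2 ?_)) O rfl
  · rintro _ rfl
    exact hl _ h3 fun i => by rw [pullbackEnd_mul_headMul, h1]
  · rintro _ rfl
    exact hl _ (by rw [pullbackEnd_mul_headMul, h2]) fun i => commute_headMul _ _

variable (k) in
/-- The differential of the double periodic complex of a torus action. -/
def totalDifferential [CharP k p] (γ : TorusPhase t) : TotalDifferential X k where
  D := (γ.left k).total (γ.right k)
  D_sub := PeriodicContraction.total_sub _ _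
  D_D := PeriodicContraction.total_total fun i j =>
    γ.commute_of_within (fun _ h => h.d_mem i) fun _ h => h.d_mem j
  D_mem j w a b hw := by
    refine PeriodicContraction.total_mem (locallyZero k Set.univ j).toAddSubgroup ?_ ?_ hw
    · exact fun i f hf => (γ.fst.contraction_d_mem _ (pullbackEnd_mem_localOperators
        t.continuous_φ (Set.mapsTo_univ _ Set.univ)) i).1 j f hf
    · exact fun i f hf => (γ.snd.contraction_d_mem _ (pullbackEnd_mem_localOperators
        t.continuous_ψ (Set.mapsTo_univ _ Set.univ)) i).1 j f hf
  D_coboundary := by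
    have h : ∀ χ : X → X, pullbackEnd χ ∈
        Subring.centralizer {(coboundary : Module.End k (List X → k))} := fun χ => by
      refine Subring.mem_centralizer_iff.2 ?_
      rintro _ rfl
      exact LinearMap.ext (coboundary_pullback χ)
    exact PeriodicContraction.total_map (coboundary : Module.End k (List X → k)).toAddMonoidHom
      (fun i f => DFunLike.congr_fun (Subring.mem_centralizer_iff.1
        (γ.fst.contraction_d_mem t.iterate_φ (h _) i) _ rfl) f)
      fun i f => DFunLike.congr_fun (Subring.mem_centralizer_iff.1
        (γ.snd.contraction_d_mem t.iterate_ψ (h _) i) _ rfl) f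
  D_nil w a b := by
    have hl : ∀ i (f : List X → k), ((γ.left k).d i • f) [] = 0 := fun i f =>
      γ.fst.contraction_d_apply_eq_zero _ i fun _ => rfl
    have hr : ∀ i (f : List X → k), ((γ.right k).d i • f) [] = 0 := fun i f =>
      γ.snd.contraction_d_apply_eq_zero _ i fun _ => rfl
    rcases a with _ | a <;> rcases b with _ | b <;>
      simp only [PeriodicContraction.total, Pi.zero_apply, Pi.add_apply, Pi.smul_apply, hl, hr,
        smul_zero, add_zero]
  D_const u := by
    have hl : ∀ i (c : k), (γ.left k).d i • (fun _ : List X => c) = 0 := fun i c => funext fun τ =>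
      γ.fst.contraction_d_apply_eq_zero _ i fun _ => rfl
    have hr : ∀ i (c : k), (γ.right k).d i • (fun _ : List X => c) = 0 := fun i c =>
      funext fun τ => γ.snd.contraction_d_apply_eq_zero _ i fun _ => rfl
    funext a b
    rcases a with _ | a <;> rcases b with _ | b <;>
      simp only [PeriodicContraction.total, Pi.zero_apply, hl, hr, smul_zero, add_zero]

lemma totalDifferential_eq [CharP k p] (γ γ' : TorusPhase t) :
    γ.totalDifferential k = γ'.totalDifferential k := by
  have h : ((γ.left k).total (γ.right k) : (ℕ → ℕ → List X → k) → ℕ → ℕ → List X → k) =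
      (γ'.left k).total (γ'.right k) := by
    funext w a b
    rcases a with _ | a <;> rcases b with _ | b <;> rfl
  simp only [totalDifferential, h]

/-- An equivariant function that is locally constant on `U` contracts the double periodic complex
near `U`. -/
def localContraction [CharP k p] (γ : TorusPhase t) {𝒰 : Set (Set X)}
    (hφ : ∀ V ∈ 𝒰, Set.MapsTo t.φ V V) (hψ : ∀ V ∈ 𝒰, Set.MapsTo t.ψ V V) {U : Set X}
    (hU : U ∈ 𝒰) (h₁ : ∀ x ∈ U, ∀ᶠ y in 𝓝 x, γ.fst.toFun y = γ.fst.toFun x)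
    (h₂ : ∀ x ∈ U, ∀ᶠ y in 𝓝 x, γ.snd.toFun y = γ.snd.toFun x) :
    LocalContraction (γ.totalDifferential k) 𝒰 U :=
  have h_zero : ∀ (w : ℕ → ℕ → List X → k) a b, (∀ a' b', a' + b' = a + b + 1 → w a' b' = 0) →
      (γ.left k).contraction (γ.right k) w a b = 0 := fun w a b hw =>
    AddSubgroup.mem_bot.1 (PeriodicContraction.contraction_mem (⊥ : AddSubgroup (List X → k))
      (fun i x hx => by simp [AddSubgroup.mem_bot.1 hx])
      (fun i x hx => by simp [AddSubgroup.mem_bot.1 hx])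
      (fun x hx => by simp [AddSubgroup.mem_bot.1 hx])
      fun a' b' h => AddSubgroup.mem_bot.2 (hw a' b' h))
  { h := (γ.left k).contraction (γ.right k)
    D_h := fun w hw h0 hnil => by
      funext a b
      exact (PeriodicContraction.total_contraction
        (fun i j => γ.commute_of_within (fun _ h => h.d_mem i) fun _ h => h.s_mem j)
        (fun i j => γ.commute_of_within (fun _ h => h.s_mem i) fun _ h => h.d_mem j)
        (fun j => γ.commute_of_within (fun _ h => h.norm_mul_proj_mem) fun _ h => h.d_mem j)
        hw h0 a b).trans (headMul_one_apply (hnil a b))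
    h_eq_zero := h_zero
    h_mem := fun V hV j w a b hw => by
      have hl : (γ.left k).Within (preservingOperators k V) := γ.left_within
        (localOperators_le V (pullbackEnd_mem_localOperators t.continuous_φ (hφ V hV)))
        fun i => headMul_mem_preservingOperators V _
      have hr : (γ.right k).Within (preservingOperators k V) := γ.right_within
        (localOperators_le V (pullbackEnd_mem_localOperators t.continuous_ψ (hψ V hV)))
        fun i => headMul_mem_preservingOperators V _
      exact PeriodicContraction.contraction_mem (locallyZero k V j).toAddSubgroup
        (fun i => hl.s_mem i j) (fun i => hr.s_mem i j) (hl.norm_mul_proj_mem j) hw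
    coboundary_h_mem := fun w hw j hj a b => by
      have hl : (γ.left k).Within (localOperators k U) := γ.left_within
        (pullbackEnd_mem_localOperators t.continuous_φ (hφ U hU)) fun i =>
          headMul_mem_localOperators fun x hx => (h₁ x hx).mono fun y hy => by
            simp [Phase.level, hy]
      have hr : (γ.right k).Within (localOperators k U) := γ.right_within
        (pullbackEnd_mem_localOperators t.continuous_ψ (hψ U hU)) fun i =>
          headMul_mem_localOperators fun x hx => (h₂ x hx).mono fun y hy => by
            simp [Phase.level, hy]
      have h := PeriodicContraction.map_contraction_sub_mem (P := γ.left k) (P' := γ.right k)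
        (locallyZero k U j).toAddSubgroup
        (coboundary : Module.End k (List X → k)).toAddMonoidHom
        (fun i f => (hl.s_mem i).2 f j hj)
        (fun i f => (mul_mem (hr.s_mem i) hl.norm_mul_proj_mem).2 f j hj) w a b
      have hz := h_zero (fun a b => (coboundary : Module.End k (List X → k)).toAddMonoidHom (w a b))
        a b fun a' b' _ => hw a' b'
      rw [hz, sub_zero] at h
      exact h }

end TorusPhase

end AlexanderSpanier

/-! ### Free actions of finite groups -/

section FreeAction

variable {G X : Type*} [Group G] [Finite G] [TopologicalSpace X] [T2Space X] [MulAction G X]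
  [ContinuousConstSMul G X]

lemma exists_isOpen_smul_notMem (hfree : ∀ (g : G) (x : X), g • x = x → g = 1) (x : X) :
    ∃ V : Set X, IsOpen V ∧ x ∈ V ∧ ∀ g : G, ∀ y ∈ V, g • y ∈ V → g = 1 := by
  have h : ∀ g : G, ∃ V : Set X, IsOpen V ∧ x ∈ V ∧ ∀ y ∈ V, g • y ∈ V → g = 1 := by
    intro g
    by_cases hg : g = 1
    · exact ⟨Set.univ, isOpen_univ, trivial, fun _ _ _ => hg⟩
    · obtain ⟨A, B, hA, hB, hxA, hxB, hAB⟩ := t2_separation fun h => hg (hfree g x h)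
      refine ⟨B ∩ (g • ·) ⁻¹' A, hB.inter (hA.preimage (continuous_const_smul g)), ⟨hxB, hxA⟩,
        fun y hy hy' => ?_⟩
      exact absurd hy'.1 (Set.disjoint_left.1 hAB hy.2)
  choose V hV hxV hV' using h
  exact ⟨⋂ g, V g, isOpen_iInter_of_finite hV, Set.mem_iInter.2 hxV, fun g y hy hy' =>
    hV' g y (Set.mem_iInter.1 hy g) (Set.mem_iInter.1 hy' g)⟩

/-- A free action of a finite group on a Hausdorff space is locally trivial. -/
lemma exists_equivariant_locally_constant (hfree : ∀ (g : G) (x : X), g • x = x → g = 1) (x : X) :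
    ∃ U : Set X, IsOpen U ∧ x ∈ U ∧ (∀ g : G, ∀ y ∈ U, g • y ∈ U) ∧
      ∃ γ : X → G, (∀ g y, γ (g • y) = g * γ y) ∧ ∀ y ∈ U, ∀ᶠ z in 𝓝 y, γ z = γ y := by
  classical
  obtain ⟨V, hV, hxV, hV'⟩ := exists_isOpen_smul_notMem hfree x
  let r : MulAction.orbitRel.Quotient G X → X := fun q =>
    if h : ∃ v ∈ V, (Quotient.mk _ v : MulAction.orbitRel.Quotient G X) = q then h.choose else q.out
  have hr : ∀ q, (Quotient.mk _ (r q) : MulAction.orbitRel.Quotient G X) = q := fun q => by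
    by_cases h : ∃ v ∈ V, (Quotient.mk _ v : MulAction.orbitRel.Quotient G X) = q
    · simp only [r, dif_pos h]
      exact h.choose_spec.2
    · simp only [r, dif_neg h]
      exact Quotient.out_eq q
  have hγ : ∀ y : X, ∃ g : G, g • r (Quotient.mk _ y) = y := fun y =>
    MulAction.orbitRel_apply.1 (Quotient.exact (hr (Quotient.mk _ y)).symm)
  choose γ hγ using hγ
  have hsmul : ∀ (g : G) (y : X), (Quotient.mk _ (g • y) : MulAction.orbitRel.Quotient G X) =
      Quotient.mk _ y := fun g y => Quotient.sound (MulAction.orbitRel_apply.2 ⟨g, rfl⟩)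
  have huniq : ∀ (g h : G) (y : X), g • y = h • y → g = h := fun g h y hy =>
    (inv_mul_eq_one.1 (hfree (h⁻¹ * g) y (by rw [mul_smul, hy, inv_smul_smul]))).symm
  have hγV : ∀ g : G, ∀ v ∈ V, γ (g • v) = g := fun g v hv => by
    have h : ∃ u ∈ V, (Quotient.mk _ u : MulAction.orbitRel.Quotient G X) = Quotient.mk _ v :=
      ⟨v, hv, rfl⟩
    have h1 : r (Quotient.mk _ v) ∈ V := by
      simp only [r, dif_pos h]
      exact h.choose_spec.1
    obtain ⟨c, hc⟩ := MulAction.orbitRel_apply.1 (Quotient.exact (hr (Quotient.mk _ v)))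
    simp only at hc
    have h2 : c = 1 := hV' c v hv (hc ▸ h1)
    rw [h2, one_smul] at hc
    have h3 := hγ (g • v)
    rw [hsmul, ← hc] at h3
    exact huniq _ _ _ h3
  refine ⟨⋃ g : G, (g⁻¹ • ·) ⁻¹' V,
    isOpen_iUnion fun g => hV.preimage (continuous_const_smul _),
    Set.mem_iUnion.2 ⟨1, by simpa using hxV⟩, fun g y hy => ?_, γ, fun g y => ?_, fun y hy => ?_⟩
  · obtain ⟨h, hh⟩ := Set.mem_iUnion.1 hy
    exact Set.mem_iUnion.2 ⟨g * h, by simpa [mul_smul] using hh⟩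
  · refine huniq _ _ (r (Quotient.mk _ y)) ?_
    have h := hγ (g • y)
    rw [hsmul] at h
    rw [h, mul_smul, hγ]
  · obtain ⟨h, hh⟩ := Set.mem_iUnion.1 hy
    have h1 : ∀ z, h⁻¹ • z ∈ V → γ z = h := fun z hz => by
      simpa using hγV h _ hz
    filter_upwards [(hV.preimage (continuous_const_smul h⁻¹)).mem_nhds hh] with z hz
    rw [h1 z hz, h1 y hh]

end FreeAction

/-- Classical Smith theory (part of Theorem 1.1): for a prime `p` and `n ≥ 1`, there is no
free continuous action of `ℤ/p × ℤ/p` on the sphere `S^n`. -/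
theorem no_free_action_of_rank_two_p_torus_on_sphere
    (p : ℕ) (hp : p.Prime) (n : ℕ) (hn : 1 ≤ n) :
    ¬ ∃ ρ : (Multiplicative (ZMod p) × Multiplicative (ZMod p)) →*
        Equiv.Perm (Metric.sphere (0 : EuclideanSpace ℝ (Fin (n + 1))) 1),
      (∀ g, Continuous (ρ g)) ∧ (∀ g x, ρ g x = x → g = 1) := by
  rintro ⟨ρ, hρ, hfree⟩
  have : Fact p.Prime := ⟨hp⟩
  let X := Metric.sphere (0 : EuclideanSpace ℝ (Fin (n + 1))) 1
  let : MulAction (Multiplicative (ZMod p) × Multiplicative (ZMod p)) X := MulAction.compHom X ρ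
  have : ContinuousConstSMul (Multiplicative (ZMod p) × Multiplicative (ZMod p)) X := ⟨hρ⟩
  have hpow : ∀ g, (ρ g)^[p] = id := fun g => by
    have hg : g ^ p = 1 := by
      refine Prod.ext ?_ ?_ <;> refine Multiplicative.toAdd.injective ?_ <;> simp
    rw [← Equiv.Perm.coe_pow, ← map_pow, hg, map_one, Equiv.Perm.coe_one]
  let g₁ : Multiplicative (ZMod p) × Multiplicative (ZMod p) := (Multiplicative.ofAdd 1, 1)
  let g₂ : Multiplicative (ZMod p) × Multiplicative (ZMod p) := (1, Multiplicative.ofAdd 1)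
  let t : AlexanderSpanier.TorusAction p X :=
    { φ := ρ g₁
      ψ := ρ g₂
      continuous_φ := hρ g₁
      continuous_ψ := hρ g₂
      iterate_φ := hpow g₁
      iterate_ψ := hpow g₂
      comm := by
        rw [← Equiv.Perm.coe_mul, ← Equiv.Perm.coe_mul, ← map_mul, ← map_mul, mul_comm] }
  choose U hU hxU hUG γ hγ hγU using
    exists_equivariant_locally_constant (G := Multiplicative (ZMod p) × Multiplicative (ZMod p))
      (X := X) hfree
  let γ' : X → AlexanderSpanier.TorusPhase t := fun x =>
    { fst :=
        { toFun := fun y => Multiplicative.toAdd (γ x y).1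
          apply_map := fun y => by
            have h : γ x (ρ g₁ y) = g₁ * γ x y := hγ x g₁ y
            simp [t, h, g₁, add_comm] }
      snd :=
        { toFun := fun y => Multiplicative.toAdd (γ x y).2
          apply_map := fun y => by
            have h : γ x (ρ g₂ y) = g₂ * γ x y := hγ x g₂ y
            simp [t, h, g₂, add_comm] }
      fst_ψ := fun y => by
        have h : γ x (ρ g₂ y) = g₂ * γ x y := hγ x g₂ y
        simp [t, h, g₂]
      snd_φ := fun y => by
        have h : γ x (ρ g₁ y) = g₁ * γ x y := hγ x g₁ y
        simp [t, h, g₁] }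
  have hfin : Module.finrank ℝ (EuclideanSpace ℝ (Fin (n + 1))) = n + 1 :=
    finrank_euclideanSpace_fin
  obtain ⟨x₀⟩ : Nonempty X := (NormedSpace.sphere_nonempty.2 zero_le_one).to_subtype
  obtain ⟨s, -, hs⟩ := (isCompact_univ (X := X)).elim_nhds_subcover U
    fun x _ => (hU x).mem_nhds (hxU x)
  let c : ℕ → X := fun i => s.toList.getD i x₀
  have hsphere := AlexanderSpanier.sphere_cohomology (k := ZMod p)
    (V := EuclideanSpace ℝ (Fin (n + 1)))
  rw [hfin] at hsphere
  refine AlexanderSpanier.not_exists_localContraction hsphere.1 hsphere.2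
    (T := (γ' x₀).totalDifferential (ZMod p)) (le_max_right s.card (n + 1))
    (U := fun i => U (c i)) (fun i => hU _) (fun x => ?_) fun i => ?_
  · obtain ⟨y, hy, hxy⟩ := Set.mem_iUnion₂.1 (hs (Set.mem_univ x))
    obtain ⟨i, hi, rfl⟩ := List.getElem_of_mem (Finset.mem_toList.2 hy)
    refine ⟨i, lt_max_of_lt_left (by simpa using hi), ?_⟩
    simpa only [c, List.getD_eq_getElem _ _ hi] using hxy
  · rw [(γ' x₀).totalDifferential_eq (γ' (c i))]
    refine (γ' (c i)).localContraction ?_ ?_ (Set.mem_range_self i) ?_ ?_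
    · rintro _ ⟨j, rfl⟩
      exact hUG _ g₁
    · rintro _ ⟨j, rfl⟩
      exact hUG _ g₂
    · exact fun x hx => (hγU _ x hx).mono fun y hy => by simp only [γ', hy]
    · exact fun x hx => (hγU _ x hx).mono fun y hy => by simp only [γ', hy]
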